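/- Let n ≥ 2, 1 ≤ p ≤ q ≤ ∞, 1 ≤ p̃ ≤ q̃ ≤ ∞, 0 < r < ∞, and let α, β be real numbers satisfying β > −n/q, α < n(1 − 1/p), Λ(α,p,p̃) ≥ Λ(β,q,q̃). Let η ∈ ℕⁿ be a multi-index with (|η| + n/p − n/q + α − β)/2 = 1/r. Then there is a constant c_η, depending only on n, p, q, r, p̃, q̃, α, β, η, such that for every measurable u₀ : ℝⁿ → ℝ the function t ↦ ‖|x|^β ((∂^η G_t) ∗ u₀)‖_{L^q_{|x|}L^{q̃}_θ} belongs to weak-L^r on (0,∞): for every λ > 0, λ · |{ t ∈ (0,∞) : ‖|x|^β ((∂^η G_t) ∗ u₀)‖_{L^q_{|x|}L^{q̃}_θ} > λ }|^{1/r} ≤ c_η ‖|x|^α u₀‖_{L^p_{|x|}L^{p̃}_θ}, where |·| denotes Lebesgue measure on (0,∞). -/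

import Mathlib

open MeasureTheory ENNReal Metric Set Filter

noncomputable section

/-- The surface measure on the unit sphere `S^{n-1} ⊂ ℝⁿ`. -/
def sphereMeasure (n : ℕ) : Measure (sphere (0 : EuclideanSpace ℝ (Fin n)) 1) :=
  Measure.toSphere (volume : Measure (EuclideanSpace ℝ (Fin n)))

/-- The `L^{p̃}(S^{n-1})` norm of `θ ↦ f (ρ θ)`. -/
def angNorm (n : ℕ) (pt : ℝ≥0∞) (f : EuclideanSpace ℝ (Fin n) → ℝ) (ρ : ℝ) : ℝ≥0∞ :=
  eLpNorm (fun θ : sphere (0 : EuclideanSpace ℝ (Fin n)) 1 =>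
    f (ρ • (θ : EuclideanSpace ℝ (Fin n)))) pt (sphereMeasure n)

/-- The mixed radial-angular norm `‖f‖_{L^p_{|x|} L^{p̃}_θ}`. -/
def mixedNorm (n : ℕ) (p pt : ℝ≥0∞) (f : EuclideanSpace ℝ (Fin n) → ℝ) : ℝ≥0∞ :=
  if p = ∞ then ⨆ ρ ∈ Ioi (0 : ℝ), angNorm n pt f ρ
  else (∫⁻ ρ in Ioi (0 : ℝ),
      angNorm n pt f ρ ^ p.toReal * ENNReal.ofReal (ρ ^ (n - 1))) ^ (1 / p.toReal)

/-- Convolution on `ℝⁿ`. -/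
def conv (n : ℕ) (k f : EuclideanSpace ℝ (Fin n) → ℝ) (x : EuclideanSpace ℝ (Fin n)) : ℝ :=
  ∫ y, k (x - y) * f y

/-- The heat kernel `G_t(x) = (4πt)^{-n/2} e^{-|x|²/(4t)}`. -/
def heatKernel (n : ℕ) (t : ℝ) (x : EuclideanSpace ℝ (Fin n)) : ℝ :=
  (4 * Real.pi * t) ^ (-(n : ℝ) / 2) * Real.exp (-‖x‖ ^ 2 / (4 * t))

/-- Partial derivative in the `i`-th coordinate direction. -/
def pderiv' (n : ℕ) (i : Fin n) (f : EuclideanSpace ℝ (Fin n) → ℝ) :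
    EuclideanSpace ℝ (Fin n) → ℝ :=
  fun x => fderiv ℝ f x (EuclideanSpace.single i 1)

/-- Iterated partial derivative `∂^η` corresponding to a multi-index `η`. -/
def multiDeriv (n : ℕ) (η : Fin n → ℕ) (f : EuclideanSpace ℝ (Fin n) → ℝ) :
    EuclideanSpace ℝ (Fin n) → ℝ :=
  (List.finRange n).foldr (fun i g => (pderiv' n i)^[η i] g) f

/-- Dilation `(S_λ f)(x) = f (x/λ)`. -/
def dilate (n : ℕ) (l : ℝ) (f : EuclideanSpace ℝ (Fin n) → ℝ) :
    EuclideanSpace ℝ (Fin n) → ℝ :=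
  fun x => f (l⁻¹ • x)

local notation "𝔼" n => EuclideanSpace ℝ (Fin n)
local notation "𝕊" n => sphere (0 : EuclideanSpace ℝ (Fin n)) 1

theorem hasTemperateGrowth_fderiv_apply {E : Type*} [NormedAddCommGroup E] [NormedSpace ℝ E]
    {P : E → ℝ} (hP : P.HasTemperateGrowth) (v : E) :
    (fun x => fderiv ℝ P x v).HasTemperateGrowth := by
  have h : (fderiv ℝ P).HasTemperateGrowth := by
    refine ⟨hP.1.fderiv_right (by simp), fun m => ?_⟩
    obtain ⟨k, C, h⟩ := hP.2 (m + 1)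
    exact ⟨k, C, fun x => by rw [norm_iteratedFDeriv_fderiv]; exact h x⟩
  exact (ContinuousLinearMap.apply ℝ ℝ v).hasTemperateGrowth.comp h

/-- The unnormalised Gaussian `e^{-|x|²/4}`. -/
def gauss (n : ℕ) (x : 𝔼 n) : ℝ := Real.exp (-‖x‖ ^ 2 / 4)

theorem pderiv'_mul_gauss (n : ℕ) (i : Fin n) {P : (𝔼 n) → ℝ} (hP : P.HasTemperateGrowth) :
    ∃ Q : (𝔼 n) → ℝ, Q.HasTemperateGrowth ∧
      pderiv' n i (fun x => P x * gauss n x) = fun x => Q x * gauss n x := by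
  set e : 𝔼 n := EuclideanSpace.single i 1
  refine ⟨fun x => fderiv ℝ P x e + P x * ((-1 / 2) * inner ℝ x e), ?_, ?_⟩
  · exact (hasTemperateGrowth_fderiv_apply hP e).add
      (hP.mul ((Function.HasTemperateGrowth.const _).mul
        (Function.hasTemperateGrowth_inner_left e)))
  · funext x
    have h1 : HasFDerivAt P (fderiv ℝ P x) x :=
      ((hP.1.differentiable (by simp)) x).hasFDerivAt
    have h2 : HasFDerivAt (fun y : 𝔼 n => -‖y‖ ^ 2 / 4) ((-1 / 4 : ℝ) • (2 • innerSL ℝ x)) x := by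
      have := (hasStrictFDerivAt_norm_sq x).hasFDerivAt.const_mul (-1 / 4 : ℝ)
      have h : (fun y : 𝔼 n => -‖y‖ ^ 2 / 4) = fun y => -1 / 4 * ‖y‖ ^ 2 := by
        funext y; ring
      rw [h]; exact this
    have h3 := h1.mul h2.exp
    unfold pderiv'
    have : HasFDerivAt (fun x => P x * gauss n x) _ x := h3
    rw [this.fderiv]
    simp [gauss, e]
    ring

theorem multiDeriv_gauss (n : ℕ) (η : Fin n → ℕ) :
    ∃ P : (𝔼 n) → ℝ, P.HasTemperateGrowth ∧
      multiDeriv n η (gauss n) = fun x => P x * gauss n x := by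
  unfold multiDeriv
  induction List.finRange n with
  | nil => exact ⟨fun _ => 1, .const 1, by simp⟩
  | cons i l ih =>
    obtain ⟨P, hP, h⟩ := ih
    rw [List.foldr_cons, h]
    induction η i with
    | zero => exact ⟨P, hP, rfl⟩
    | succ k ihk =>
      obtain ⟨Q, hQ, hk⟩ := ihk
      rw [Function.iterate_succ_apply', hk]
      exact pderiv'_mul_gauss n i hQ

theorem one_add_pow_mul_exp_neg_sq_le (k : ℕ) {c : ℝ} (hc : 0 < c) :
    ∃ C, 0 < C ∧ ∀ d : ℝ, 0 ≤ d → (1 + d) ^ k * Real.exp (-(c * d ^ 2)) ≤ C := by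
  refine ⟨k.factorial * Real.exp (1 + 1 / (4 * c)), by positivity, fun d hd => ?_⟩
  have h2 := Real.pow_div_factorial_le_exp (1 + d) (by positivity) k
  have h3 : (1 + d) ^ k ≤ k.factorial * Real.exp (1 + d) := by
    rw [div_le_iff₀ (by positivity)] at h2; linarith
  calc (1 + d) ^ k * Real.exp (-(c * d ^ 2))
      ≤ k.factorial * Real.exp (1 + d) * Real.exp (-(c * d ^ 2)) := by gcongr
    _ = k.factorial * Real.exp (1 + d - c * d ^ 2) := by
      rw [mul_assoc, ← Real.exp_add]; ring_nf
    _ ≤ _ := by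
      gcongr
      have : d - c * d ^ 2 ≤ 1 / (4 * c) := by
        rw [le_div_iff₀ (by positivity)]
        nlinarith [sq_nonneg (2 * c * d - 1)]
      linarith

theorem multiDeriv_gauss_le (n : ℕ) (η : Fin n → ℕ) :
    ∃ C, 0 < C ∧ ∀ x, |multiDeriv n η (gauss n) x| ≤ C * Real.exp (-‖x‖ ^ 2 / 8) := by
  obtain ⟨P, hP, h⟩ := multiDeriv_gauss n η
  obtain ⟨k, C, hC⟩ := hP.2 0
  obtain ⟨D, hD, hD'⟩ := one_add_pow_mul_exp_neg_sq_le k (c := 1 / 8) (by norm_num)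
  refine ⟨(|C| + 1) * D, by positivity, fun x => ?_⟩
  rw [h, abs_mul, gauss, abs_of_pos (Real.exp_pos _)]
  have h0 : |P x| ≤ (|C| + 1) * (1 + ‖x‖) ^ k := by
    have := hC x
    simp only [norm_iteratedFDeriv_zero, Real.norm_eq_abs] at this
    refine this.trans ?_
    gcongr
    linarith [le_abs_self C]
  have h1 : Real.exp (-‖x‖ ^ 2 / 4)
      = Real.exp (-(1 / 8 * ‖x‖ ^ 2)) * Real.exp (-‖x‖ ^ 2 / 8) := by
    rw [← Real.exp_add]; ring_nf
  calc |P x| * Real.exp (-‖x‖ ^ 2 / 4)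
      ≤ (|C| + 1) * (1 + ‖x‖) ^ k *
        (Real.exp (-(1 / 8 * ‖x‖ ^ 2)) * Real.exp (-‖x‖ ^ 2 / 8)) := by rw [h1]; gcongr
    _ = (|C| + 1) * ((1 + ‖x‖) ^ k * Real.exp (-(1 / 8 * ‖x‖ ^ 2))) *
        Real.exp (-‖x‖ ^ 2 / 8) := by ring
    _ ≤ _ := by gcongr; exact hD' _ (norm_nonneg x)

theorem multiDeriv_const_mul_comp_smul (n : ℕ) (η : Fin n → ℕ) (f : (𝔼 n) → ℝ) (a c : ℝ) :
    multiDeriv n η (fun x => a * f (c • x)) =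
      fun x => a * c ^ (∑ i, η i) * multiDeriv n η f (c • x) := by
  unfold multiDeriv
  rw [Fin.sum_univ_def]
  induction List.finRange n with
  | nil => simp
  | cons i l ih =>
    rw [List.foldr_cons, ih, List.foldr_cons, List.map_cons, List.sum_cons]
    generalize l.foldr (fun i g => (pderiv' n i)^[η i] g) f = g
    induction η i with
    | zero => simp
    | succ k ihk =>
      rw [Function.iterate_succ_apply', ihk, Function.iterate_succ_apply']
      generalize (pderiv' n i)^[k] g = g'
      funext x
      unfold pderiv'
      have := fderiv_comp_smul (𝕜 := ℝ) (f := g') (x := x) c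
      have h2 := congrFun (fderiv_const_smul_field (𝕜 := ℝ) (a * c ^ (k + (l.map η).sum)) (f := fun x => g' (c • x))) x
      have h3 : (fun x => a * c ^ (k + (l.map η).sum) * g' (c • x))
          = (a * c ^ (k + (l.map η).sum)) • fun x => g' (c • x) := rfl
      rw [h3, h2, Pi.smul_apply, this]
      simp only [smul_apply, smul_eq_mul]
      ring

theorem heatKernel_eq (n : ℕ) {s : ℝ} (hs : 0 < s) :
    heatKernel n (s ^ 2) = fun x => ((4 * Real.pi) ^ (-(n : ℝ) / 2) * (s ^ n)⁻¹) *
      gauss n (s⁻¹ • x) := by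
  funext x
  unfold heatKernel gauss
  have h1 : (4 * Real.pi * s ^ 2) ^ (-(n : ℝ) / 2)
      = (4 * Real.pi) ^ (-(n : ℝ) / 2) * (s ^ n)⁻¹ := by
    rw [Real.mul_rpow (by positivity) (by positivity), ← Real.rpow_natCast s 2,
      ← Real.rpow_mul hs.le, ← Real.rpow_natCast s n, ← Real.rpow_neg hs.le]
    congr 2
    push_cast; ring
  rw [h1, norm_smul, norm_inv, Real.norm_of_nonneg hs.le]
  congr 2
  field_simp

theorem enorm_conv_multiDeriv_heatKernel_le (n : ℕ) (η : Fin n → ℕ) :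
    ∃ C, 0 < C ∧ ∀ (u : (𝔼 n) → ℝ) (s : ℝ) (x : 𝔼 n), 0 < s →
      ‖conv n (multiDeriv n η (heatKernel n (s ^ 2))) u (s • x)‖ₑ ≤
        ENNReal.ofReal (C * s ^ (-(∑ i, (η i : ℝ)))) *
          ∫⁻ y, ENNReal.ofReal (Real.exp (-‖x - y‖ ^ 2 / 8)) * ‖u (s • y)‖ₑ := by
  obtain ⟨C, hC, h⟩ := multiDeriv_gauss_le n η
  set K := (4 * Real.pi) ^ (-(n : ℝ) / 2) with hK
  have hK0 : 0 < K := by positivity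
  refine ⟨K * C, by positivity, fun u s x hs => ?_⟩
  set Γ := multiDeriv n η (gauss n) with hΓ
  have h1 : conv n (multiDeriv n η (heatKernel n (s ^ 2))) u (s • x)
      = K * s ^ (-(∑ i, (η i : ℝ))) * ∫ y, Γ (x - y) * u (s • y) := by
    rw [heatKernel_eq n hs, multiDeriv_const_mul_comp_smul]
    have h2 := Measure.integral_comp_smul (volume : Measure (𝔼 n))
      (fun y => Γ (x - s⁻¹ • y) * u y) s
    simp only [smul_smul, inv_mul_cancel₀ hs.ne', one_smul, finrank_euclideanSpace,
      Fintype.card_fin] at h2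
    unfold conv
    rw [h2]
    have h3 : ∀ y : 𝔼 n, s⁻¹ • (s • x - y) = x - s⁻¹ • y := fun y => by
      rw [smul_sub, smul_smul, inv_mul_cancel₀ hs.ne', one_smul]
    have h4 : s ^ (-(∑ i, (η i : ℝ))) = s⁻¹ ^ (∑ i, η i) := by
      rw [Real.rpow_neg hs.le, inv_pow, ← Real.rpow_natCast]; push_cast; rfl
    simp only [h3]
    rw [h4, abs_of_pos (by positivity), smul_eq_mul, ← mul_assoc, ← integral_const_mul]
    congr 1; funext y
    rw [← hΓ]; ring
  rw [h1, enorm_mul]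
  have h5 : ‖∫ y, Γ (x - y) * u (s • y)‖ₑ ≤ ∫⁻ y, ENNReal.ofReal C *
      (ENNReal.ofReal (Real.exp (-‖x - y‖ ^ 2 / 8)) * ‖u (s • y)‖ₑ) := by
    refine (enorm_integral_le_lintegral_enorm _).trans (lintegral_mono fun y => ?_)
    rw [enorm_mul, ← mul_assoc, ← ENNReal.ofReal_mul hC.le]
    gcongr
    rw [Real.enorm_eq_ofReal_abs]
    exact ENNReal.ofReal_le_ofReal (h _)
  refine (mul_le_mul_right h5 _).trans ?_
  rw [lintegral_const_mul' _ _ ENNReal.ofReal_ne_top, ← mul_assoc,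
    Real.enorm_eq_ofReal (by positivity), ← ENNReal.ofReal_mul (by positivity)]
  apply le_of_eq
  congr 2; ring

section Schur

variable {X Y : Type*} [MeasurableSpace X] [MeasurableSpace Y] {μ : Measure X} {ν : Measure Y}

/-- Minkowski's integral inequality. -/
theorem lintegral_lintegral_rpow_le [IsFiniteMeasure μ] [SFinite ν] {H : X → Y → ℝ≥0∞}
    (hH : Measurable (Function.uncurry H)) {q : ℝ} (hq : 1 ≤ q) :
    (∫⁻ x, (∫⁻ y, H x y ∂ν) ^ q ∂μ) ^ (1 / q) ≤ ∫⁻ y, (∫⁻ x, H x y ^ q ∂μ) ^ (1 / q) ∂ν := by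
  have hq0 : 0 < q := by linarith
  have hF : Measurable fun x => ∫⁻ y, H x y ∂ν := hH.lintegral_prod_right'
  have hHy : ∀ y, Measurable fun x => H x y := fun y => hH.of_uncurry_right
  rcases hq.eq_or_lt with rfl | hq1
  · simp only [ENNReal.rpow_one, div_one]
    exact (lintegral_lintegral_swap hH.aemeasurable).le
  set F := fun x => ∫⁻ y, H x y ∂ν with hFdef
  set R := ∫⁻ y, (∫⁻ x, H x y ^ q ∂μ) ^ (1 / q) ∂ν
  have hconj : q.HolderConjugate (q / (q - 1)) := Real.HolderConjugate.conjExponent hq1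
  have key : ∀ N : ℕ, ∫⁻ x, (min (F x) N) ^ q ∂μ ≤ R ^ q := by
    intro N
    set T := fun x => min (F x) (N : ℝ≥0∞) with hT
    have hTm : Measurable T := hF.min measurable_const
    set I := ∫⁻ x, T x ^ q ∂μ with hI
    have hItop : I ≠ ⊤ := by
      refine ne_top_of_le_ne_top ?_ (lintegral_mono (g := fun _ => (N : ℝ≥0∞) ^ q) fun x =>
        ENNReal.rpow_le_rpow (min_le_right _ _) hq0.le)
      rw [lintegral_const]
      exact ENNReal.mul_ne_top (ENNReal.rpow_ne_top_of_nonneg hq0.le (by simp))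
        (measure_ne_top _ _)
    have h1 : I ≤ R * I ^ (1 / (q / (q - 1))) := by
      calc I ≤ ∫⁻ x, ∫⁻ y, H x y * T x ^ (q - 1) ∂ν ∂μ := by
            refine lintegral_mono fun x => ?_
            rw [lintegral_mul_const _ hH.of_uncurry_left]
            calc T x ^ q = T x ^ (1 + (q - 1)) := by ring_nf
              _ = T x * T x ^ (q - 1) := by
                rw [ENNReal.rpow_add_of_nonneg _ _ zero_le_one (by linarith), ENNReal.rpow_one]
              _ ≤ _ := by gcongr; exact min_le_left _ _
        _ = ∫⁻ y, ∫⁻ x, H x y * T x ^ (q - 1) ∂μ ∂ν :=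
            lintegral_lintegral_swap
              (hH.mul ((hTm.comp measurable_fst).pow_const _)).aemeasurable
        _ ≤ ∫⁻ y, (∫⁻ x, H x y ^ q ∂μ) ^ (1 / q) * I ^ (1 / (q / (q - 1))) ∂ν := by
            refine lintegral_mono fun y => ?_
            have := ENNReal.lintegral_mul_le_Lp_mul_Lq μ hconj (hHy y).aemeasurable
              (hTm.pow_const (q - 1)).aemeasurable
            refine this.trans_eq ?_
            congr 3
            funext x
            rw [← ENNReal.rpow_mul]
            congr 1
            field_simp [(by linarith : q - 1 ≠ 0)]
        _ = _ := lintegral_mul_const' _ _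
            (ENNReal.rpow_ne_top_of_nonneg (by have := hconj.symm.pos; positivity) hItop)
    rcases eq_or_ne I 0 with h0 | h0
    · rw [h0]; exact zero_le
    have h2 : I ^ (1 / q) * I ^ (1 / (q / (q - 1))) = I := by
      rw [← ENNReal.rpow_add _ _ h0 hItop, one_div, one_div, hconj.inv_add_inv_eq_one,
        ENNReal.rpow_one]
    have h3 : I ^ (1 / q) ≤ R := by
      have h4 : I ^ (1 / (q / (q - 1))) ≠ 0 := by simp [h0, hItop]
      have h5 : I ^ (1 / (q / (q - 1))) ≠ ⊤ := by simp [h0, hItop]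
      rw [← ENNReal.mul_le_mul_iff_left h4 h5, h2]
      exact h1
    calc I = (I ^ (1 / q)) ^ q := by
          rw [← ENNReal.rpow_mul, one_div_mul_cancel hq0.ne', ENNReal.rpow_one]
      _ ≤ R ^ q := by gcongr
  have hlim : ∫⁻ x, F x ^ q ∂μ = ⨆ N : ℕ, ∫⁻ x, (min (F x) N) ^ q ∂μ := by
    rw [← lintegral_iSup (fun N => (hF.min measurable_const).pow_const _)]
    · congr 1; funext x
      have : F x = ⨆ N : ℕ, min (F x) N := by
        rw [← inf_iSup_eq, ENNReal.iSup_natCast, inf_top_eq]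
      conv_lhs => rw [this]
      exact (ENNReal.orderIsoRpow q hq0).map_iSup _
    · intro N M hNM x
      simp only
      gcongr
  rw [hlim]
  calc (⨆ N : ℕ, ∫⁻ x, (min (F x) N) ^ q ∂μ) ^ (1 / q) ≤ (R ^ q) ^ (1 / q) := by
        gcongr; exact iSup_le key
    _ = R := by rw [← ENNReal.rpow_mul, mul_one_div_cancel hq0.ne', ENNReal.rpow_one]

/-- Hölder's inequality against a kernel `k` of mass at most `A`. -/
theorem lintegral_mul_le_rpow_mul {k f : Y → ℝ≥0∞} (hk : Measurable k) (hf : Measurable f)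
    {A : ℝ≥0∞} (hA : ∫⁻ y, k y ∂ν ≤ A) {p : ℝ} (hp : 1 ≤ p) :
    ∫⁻ y, k y * f y ∂ν ≤ A ^ (1 - 1 / p) * (∫⁻ y, k y * f y ^ p ∂ν) ^ (1 / p) := by
  rcases hp.eq_or_lt with rfl | hp1
  · simp
  have hconj := (Real.HolderConjugate.conjExponent hp1).symm
  have h := ENNReal.lintegral_mul_le_Lp_mul_Lq (ν.withDensity k) hconj
    (f := fun _ => 1) (g := f) aemeasurable_const hf.aemeasurable
  simp only [Pi.mul_apply, one_mul, ENNReal.one_rpow] at h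
  rw [lintegral_withDensity_eq_lintegral_mul _ hk hf,
    lintegral_withDensity_eq_lintegral_mul _ hk (hf.pow_const p),
    lintegral_withDensity_eq_lintegral_mul _ hk measurable_const] at h
  simp only [Pi.mul_apply, mul_one] at h
  refine h.trans ?_
  have : 1 / (Real.conjExponent p) = 1 - 1 / p := by
    unfold Real.conjExponent; field_simp
  rw [this]
  gcongr
  rw [sub_nonneg, div_le_one (by linarith)]; exact hp

theorem lintegral_mul_rpow_kernel_le [SFinite μ] [SFinite ν] {k : X → Y → ℝ≥0∞}
    (hk : Measurable (Function.uncurry k)) {w : X → ℝ≥0∞} (hw : Measurable w)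
    {g : Y → ℝ≥0∞} (hg : Measurable g) {A B : ℝ≥0∞} {p q : ℝ} (hp : 1 ≤ p) (hpq : p ≤ q)
    (hB : ∀ x y, k x y ≤ B) (hA : ∀ y, ∫⁻ x, k x y * w x ^ q ∂μ ≤ A) :
    ∫⁻ x, (w x * (∫⁻ y, k x y * g y ^ p ∂ν) ^ (1 / p)) ^ q ∂μ ≤
      A * B ^ (q / p - 1) * (∫⁻ y, g y ^ p ∂ν) ^ (q / p) := by
  have hp0 : 0 < p := by linarith
  have hq0 : 0 < q := by linarith
  have hqp : 0 ≤ q / p - 1 := by rw [sub_nonneg, one_le_div hp0]; exact hpq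
  set G := ∫⁻ y, g y ^ p ∂ν with hG
  have hI : ∀ x, ∫⁻ y, k x y * g y ^ p ∂ν ≤ B * G := fun x => by
    rw [← lintegral_const_mul _ (hg.pow_const p)]
    exact lintegral_mono fun y => by gcongr; exact hB x y
  have hm : Measurable (Function.uncurry fun x y => k x y * g y ^ p) :=
    hk.mul ((hg.comp measurable_snd).pow_const p)
  calc ∫⁻ x, (w x * (∫⁻ y, k x y * g y ^ p ∂ν) ^ (1 / p)) ^ q ∂μ
      ≤ ∫⁻ x, (B * G) ^ (q / p - 1) * ∫⁻ y, w x ^ q * (k x y * g y ^ p) ∂ν ∂μ := by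
        refine lintegral_mono fun x => ?_
        rw [lintegral_const_mul _ hm.of_uncurry_left,
          ENNReal.mul_rpow_of_nonneg _ _ hq0.le, ← ENNReal.rpow_mul, mul_left_comm]
        gcongr
        calc (∫⁻ y, k x y * g y ^ p ∂ν) ^ (1 / p * q)
            = (∫⁻ y, k x y * g y ^ p ∂ν) ^ (q / p - 1 + 1) := by congr 1; ring
          _ = (∫⁻ y, k x y * g y ^ p ∂ν) ^ (q / p - 1) * ∫⁻ y, k x y * g y ^ p ∂ν := by
            rw [ENNReal.rpow_add_of_nonneg _ _ hqp zero_le_one, ENNReal.rpow_one]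
          _ ≤ _ := by gcongr; exact hI x
    _ = (B * G) ^ (q / p - 1) * ∫⁻ y, ∫⁻ x, w x ^ q * (k x y * g y ^ p) ∂μ ∂ν := by
        have hm' : Measurable (Function.uncurry fun x y => w x ^ q * (k x y * g y ^ p)) :=
          ((hw.comp measurable_fst).pow_const q).mul hm
        rw [lintegral_const_mul _ (f := fun x => ∫⁻ y, w x ^ q * (k x y * g y ^ p) ∂ν)
            hm'.lintegral_prod_right', lintegral_lintegral_swap hm'.aemeasurable]
    _ ≤ (B * G) ^ (q / p - 1) * ∫⁻ y, A * g y ^ p ∂ν := by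
        gcongr with y
        calc ∫⁻ x, w x ^ q * (k x y * g y ^ p) ∂μ
            = ∫⁻ x, k x y * w x ^ q * g y ^ p ∂μ := by congr 1; funext x; ring
          _ = (∫⁻ x, k x y * w x ^ q ∂μ) * g y ^ p :=
            lintegral_mul_const _ (hk.of_uncurry_right.mul
              (hw.pow_const q))
          _ ≤ _ := by gcongr; exact hA y
    _ = A * B ^ (q / p - 1) * G ^ (q / p) := by
        rw [lintegral_const_mul _ (hg.pow_const p), ENNReal.mul_rpow_of_nonneg _ _ hqp]
        have : G ^ (q / p) = G ^ (q / p - 1) * G := by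
          conv_rhs => rw [← ENNReal.rpow_one G]
          rw [← ENNReal.rpow_mul, one_mul, ← ENNReal.rpow_add_of_nonneg _ _ hqp zero_le_one]
          congr 1; ring
        rw [this, ← hG]; ring

theorem lintegral_kernel_le_top {k : Y → ℝ≥0∞} (hk : Measurable k) {f : Y → ℝ≥0∞}
    (hf : Measurable f) {A B : ℝ≥0∞} (hB : ∀ y, k y ≤ B) (hA : ∫⁻ y, k y ∂ν ≤ A)
    {p : ℝ≥0∞} (hp : 1 ≤ p) :
    ∫⁻ y, k y * f y ∂ν ≤ A ^ (1 - p⁻¹.toReal) * B ^ p⁻¹.toReal * eLpNorm f p ν := by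
  rcases eq_or_ne p ⊤ with rfl | hpt
  · simp only [inv_top, toReal_zero, sub_zero, rpow_one, rpow_zero, mul_one, eLpNorm_exponent_top]
    calc ∫⁻ y, k y * f y ∂ν ≤ ∫⁻ y, k y * eLpNormEssSup f ν ∂ν := by
          refine lintegral_mono_ae ?_
          filter_upwards [enorm_ae_le_eLpNormEssSup f ν] with y hy
          gcongr
          simpa using hy
      _ = (∫⁻ y, k y ∂ν) * eLpNormEssSup f ν := lintegral_mul_const _ hk
      _ ≤ _ := by gcongr
  · have hp0 : p ≠ 0 := (zero_lt_one.trans_le hp).ne'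
    have hp1 : 1 ≤ p.toReal := by
      rw [← ENNReal.toReal_one]; exact ENNReal.toReal_mono hpt hp
    have hp2 : 0 < p.toReal := by linarith
    rw [eLpNorm_eq_lintegral_rpow_enorm_toReal hp0 hpt, ENNReal.toReal_inv, mul_assoc]
    refine (lintegral_mul_le_rpow_mul hk hf hA hp1).trans ?_
    rw [one_div]
    gcongr
    rw [← ENNReal.mul_rpow_of_nonneg _ _ (by positivity)]
    gcongr
    rw [← lintegral_const_mul _ (by simpa using hf.pow_const _)]
    refine lintegral_mono fun y => ?_
    simp only [enorm_eq_self]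
    gcongr
    exact hB y

/-- Young's inequality for kernels. -/
theorem lintegral_kernel_rpow_le [SFinite μ] [SFinite ν] {k : X → Y → ℝ≥0∞}
    (hk : Measurable (Function.uncurry k)) {f : Y → ℝ≥0∞} (hf : Measurable f)
    {A B : ℝ≥0∞} (hB : ∀ x y, k x y ≤ B) (hA : ∀ x, ∫⁻ y, k x y ∂ν ≤ A)
    (hA' : ∀ y, ∫⁻ x, k x y ∂μ ≤ A) {p q : ℝ≥0∞} (hp : 1 ≤ p) (hpq : p ≤ q) (hq : q ≠ ⊤) :
    (∫⁻ x, (∫⁻ y, k x y * f y ∂ν) ^ q.toReal ∂μ) ^ (1 / q.toReal) ≤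
      A ^ (1 - p⁻¹.toReal + q⁻¹.toReal) * B ^ (p⁻¹.toReal - q⁻¹.toReal) * eLpNorm f p ν := by
  have hpt : p ≠ ⊤ := ne_top_of_le_ne_top hq hpq
  have hp0 : p ≠ 0 := (zero_lt_one.trans_le hp).ne'
  have hp1 : 1 ≤ p.toReal := by
    rw [← ENNReal.toReal_one]; exact ENNReal.toReal_mono hpt hp
  have hpq' : p.toReal ≤ q.toReal := ENNReal.toReal_mono hq hpq
  rw [eLpNorm_eq_lintegral_rpow_enorm_toReal hp0 hpt, ENNReal.toReal_inv, ENNReal.toReal_inv]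
  simp only [enorm_eq_self]
  generalize p.toReal = a at *
  generalize q.toReal = b at *
  have ha0 : 0 < a := by linarith
  have hb0 : 0 < b := by linarith
  have ha2 : 0 ≤ 1 - 1 / a := by rw [sub_nonneg, div_le_one ha0]; exact hp1
  have hba : 0 ≤ b / a - 1 := by rw [sub_nonneg, one_le_div ha0]; exact hpq'
  have h1 := lintegral_mul_rpow_kernel_le (μ := μ) (ν := ν) hk (w := fun _ => A ^ (1 - 1 / a))
    measurable_const hf (A := A * (A ^ (1 - 1 / a)) ^ b) hp1 hpq' hB (fun y => by
      rw [lintegral_mul_const _ hk.of_uncurry_right]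
      gcongr; exact hA' y)
  calc (∫⁻ x, (∫⁻ y, k x y * f y ∂ν) ^ b ∂μ) ^ (1 / b)
      ≤ (∫⁻ x, (A ^ (1 - 1 / a) * (∫⁻ y, k x y * f y ^ a ∂ν) ^ (1 / a)) ^ b ∂μ) ^ (1 / b) := by
        gcongr with x
        exact lintegral_mul_le_rpow_mul hk.of_uncurry_left
          hf (hA x) hp1
    _ ≤ (A * (A ^ (1 - 1 / a)) ^ b * B ^ (b / a - 1) *
          (∫⁻ y, f y ^ a ∂ν) ^ (b / a)) ^ (1 / b) := by gcongr
    _ = _ := by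
        have hb' : (0:ℝ) ≤ 1 / b := by positivity
        rw [ENNReal.mul_rpow_of_nonneg _ _ hb', ENNReal.mul_rpow_of_nonneg _ _ hb',
          ENNReal.mul_rpow_of_nonneg _ _ hb', ← ENNReal.rpow_mul, ← ENNReal.rpow_mul,
          ← ENNReal.rpow_mul, ← ENNReal.rpow_mul, ← ENNReal.rpow_add_of_nonneg _ _ hb'
            (by positivity)]
        have e1 : 1 / b + (1 - 1 / a) * (b * (1 / b)) = 1 - a⁻¹ + b⁻¹ := by field_simp; ring
        have e2 : (b / a - 1) * (1 / b) = a⁻¹ - b⁻¹ := by field_simp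
        have e3 : b / a * (1 / b) = 1 / a := by field_simp
        rw [← e1, ← e2, e3]

/-- Young's inequality for kernels, superposed over a parameter `z`. -/
theorem eLpNorm_lintegral_kernel_le {Z : Type*} [MeasurableSpace Z] {τ : Measure Z} [SFinite τ]
    [IsFiniteMeasure μ] [SFinite ν] {k : Z → X → Y → ℝ≥0∞}
    (hk : Measurable fun z : Z × X × Y => k z.1 z.2.1 z.2.2)
    {f : Z → Y → ℝ≥0∞} (hf : Measurable (Function.uncurry f))
    {A B : Z → ℝ≥0∞} (hB : ∀ᵐ z ∂τ, ∀ x y, k z x y ≤ B z)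
    (hA : ∀ᵐ z ∂τ, ∀ x, ∫⁻ y, k z x y ∂ν ≤ A z)
    (hA' : ∀ᵐ z ∂τ, ∀ y, ∫⁻ x, k z x y ∂μ ≤ A z) {p q : ℝ≥0∞} (hp : 1 ≤ p) (hpq : p ≤ q) :
    eLpNorm (fun x => ∫⁻ z, ∫⁻ y, k z x y * f z y ∂ν ∂τ) q μ ≤
      ∫⁻ z, A z ^ (1 - p⁻¹.toReal + q⁻¹.toReal) * B z ^ (p⁻¹.toReal - q⁻¹.toReal) *
        eLpNorm (f z) p ν ∂τ := by
  have hkz : ∀ z, Measurable (Function.uncurry (k z)) := fun z =>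
    hk.comp (by fun_prop : Measurable fun x : X × Y => (z, x))
  have hfz : ∀ z, Measurable (f z) := fun z =>
    hf.of_uncurry_left
  rcases eq_or_ne q ⊤ with rfl | hq
  · simp only [inv_top, toReal_zero, add_zero, sub_zero, eLpNorm_exponent_top]
    refine eLpNormEssSup_le_of_ae_enorm_bound (ae_of_all _ fun x => ?_)
    rw [enorm_eq_self]
    refine lintegral_mono_ae ?_
    filter_upwards [hB, hA] with z hBz hAz
    exact lintegral_kernel_le_top (hkz z).of_uncurry_left
      (hfz z) (hBz x) (hAz x) hp
  · have hq1 : 1 ≤ q.toReal := by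
      rw [← ENNReal.toReal_one]; exact ENNReal.toReal_mono hq (hp.trans hpq)
    rw [eLpNorm_eq_lintegral_rpow_enorm_toReal (zero_lt_one.trans_le (hp.trans hpq)).ne' hq]
    simp only [enorm_eq_self]
    have hm : Measurable fun x : (X × Z) × Y => k x.1.2 x.1.1 x.2 * f x.1.2 x.2 :=
      (hk.comp (by fun_prop : Measurable fun x : (X × Z) × Y => (x.1.2, x.1.1, x.2))).mul
        (hf.comp (by fun_prop : Measurable fun x : (X × Z) × Y => (x.1.2, x.2)))
    refine (lintegral_lintegral_rpow_le (μ := μ) (ν := τ)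
      (H := fun x z => ∫⁻ y, k z x y * f z y ∂ν) hm.lintegral_prod_right' hq1).trans ?_
    refine lintegral_mono_ae ?_
    filter_upwards [hB, hA, hA'] with z hBz hAz hAz'
    exact lintegral_kernel_rpow_le (hkz z) (hfz z) hBz hAz hAz' hp hpq hq

/-- Measurability of a partial `L^p` norm. -/
theorem measurable_eLpNorm_right [SFinite ν] {f : X → Y → ℝ≥0∞}
    (hf : Measurable (Function.uncurry f)) (p : ℝ≥0∞) :
    Measurable fun x => eLpNorm (f x) p ν := by
  rcases eq_or_ne p 0 with rfl | hp0
  · simp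
  rcases eq_or_ne p ⊤ with rfl | hp
  · refine measurable_of_Ioi fun a => ?_
    have : (fun x => eLpNorm (f x) ⊤ ν) ⁻¹' Ioi a = {x | 0 < ν {y | a < f x y}} := by
      ext x
      simp only [eLpNorm_exponent_top, mem_preimage, mem_Ioi, mem_ofPred_eq, pos_iff_ne_zero]
      rw [← not_iff_not, not_lt, not_not]
      have : eLpNormEssSup (f x) ν ≤ a ↔ ∀ᵐ y ∂ν, f x y ≤ a := by
        constructor
        · intro h
          filter_upwards [enorm_ae_le_eLpNormEssSup (f x) ν] with y hy
          exact (by simpa using hy : f x y ≤ _).trans h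
        · intro h
          exact eLpNormEssSup_le_of_ae_enorm_bound (by simpa using h)
      rw [this, ae_iff]
      simp
    rw [this]
    have hs : MeasurableSet {z : X × Y | a < f z.1 z.2} := hf measurableSet_Ioi
    exact measurableSet_lt measurable_const (measurable_measure_prodMk_left hs)
  · simp only [eLpNorm_eq_lintegral_rpow_enorm_toReal hp0 hp, enorm_eq_self]
    exact (hf.pow_const _).lintegral_prod_right'.pow_const _

end Schur

instance isFiniteMeasure_sphereMeasure (n : ℕ) : IsFiniteMeasure (sphereMeasure n) := by
  unfold sphereMeasure; infer_instance

/-- Integration in polar coordinates. -/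
theorem lintegral_polar (n : ℕ) {f : (𝔼 n) → ℝ≥0∞} (hf : Measurable f) (hn : n ≠ 0) :
    ∫⁻ x, f x = ∫⁻ r in Ioi (0 : ℝ), ENNReal.ofReal (r ^ (n - 1)) *
      ∫⁻ θ : 𝕊 n, f (r • (θ : 𝔼 n)) ∂sphereMeasure n := by
  have : Nonempty (Fin n) := ⟨⟨0, Nat.pos_of_ne_zero hn⟩⟩
  have mp := (volume : Measure (𝔼 n)).measurePreserving_homeomorphUnitSphereProd
  rw [finrank_euclideanSpace, Fintype.card_fin] at mp
  set h := homeomorphUnitSphereProd (𝔼 n)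
  have hg : Measurable fun z : (𝕊 n) × Ioi (0 : ℝ) => f ((z.2 : ℝ) • (z.1 : 𝔼 n)) :=
    hf.comp (by fun_prop)
  have h1 : ∀ x : ({0}ᶜ : Set (𝔼 n)), f x = f (((h x).2 : ℝ) • ((h x).1 : 𝔼 n)) := fun x => by
    simp [h, smul_smul, mul_inv_cancel₀ (norm_ne_zero_iff.2 x.2)]
  calc ∫⁻ x, f x = ∫⁻ x in ({0}ᶜ : Set (𝔼 n)), f x := by rw [restrict_compl_singleton]
    _ = ∫⁻ x : ({0}ᶜ : Set (𝔼 n)), f x ∂(volume.comap Subtype.val) :=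
      (lintegral_subtype_comap (measurableSet_singleton _).compl _).symm
    _ = ∫⁻ x : ({0}ᶜ : Set (𝔼 n)), f (((h x).2 : ℝ) • ((h x).1 : 𝔼 n)) ∂(volume.comap Subtype.val) := by
      simp_rw [← h1]
    _ = ∫⁻ z, f ((z.2 : ℝ) • (z.1 : 𝔼 n)) ∂((sphereMeasure n).prod
          (Measure.volumeIoiPow (n - 1))) :=
      mp.lintegral_comp hg
    _ = ∫⁻ r, ∫⁻ θ : 𝕊 n, f ((r : ℝ) • (θ : 𝔼 n)) ∂sphereMeasure n
          ∂(Measure.volumeIoiPow (n - 1)) := lintegral_prod_symm' _ hg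
    _ = _ := by
      have hm : Measurable fun r : Ioi (0 : ℝ) =>
          ∫⁻ θ : 𝕊 n, f ((r : ℝ) • (θ : 𝔼 n)) ∂sphereMeasure n := hg.lintegral_prod_left'
      rw [Measure.volumeIoiPow, lintegral_withDensity_eq_lintegral_mul _ (by fun_prop) hm]
      exact lintegral_subtype_comap measurableSet_Ioi (fun r : ℝ => ENNReal.ofReal (r ^ (n - 1)) *
        ∫⁻ θ : 𝕊 n, f (r • (θ : 𝔼 n)) ∂sphereMeasure n)

theorem norm_smul_sub_smul_sq {E : Type*} [NormedAddCommGroup E] [InnerProductSpace ℝ E]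
    {x y : E} (hx : ‖x‖ = 1) (hy : ‖y‖ = 1) (a b : ℝ) :
    ‖a • x - b • y‖ ^ 2 = (a - b) ^ 2 + a * b * ‖x - y‖ ^ 2 := by
  rw [norm_sub_sq_real, norm_sub_sq_real, norm_smul, norm_smul, hx, hy, real_inner_smul_left,
    real_inner_smul_right, mul_one, mul_one, Real.norm_eq_abs, Real.norm_eq_abs, sq_abs, sq_abs]
  ring

/-- Gaussians concentrated on a spherical cap have the mass of a ball in dimension `n - 1`. -/
theorem lintegral_sphere_exp_le (n : ℕ) (hn : n ≠ 0) :
    ∃ C : ℝ, 0 < C ∧ ∀ (τ : ℝ) (θ : 𝕊 n), 0 ≤ τ →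
      ∫⁻ ω : 𝕊 n, ENNReal.ofReal (Real.exp (-(τ * ‖(θ : 𝔼 n) - ω‖ ^ 2))) ∂sphereMeasure n ≤
        ENNReal.ofReal (C * (1 + τ) ^ (-((n : ℝ) - 1) / 2)) := by
  set V := (sphereMeasure n).real univ with hV
  have hI : ∫ x : 𝔼 n, Real.exp (-‖x‖ ^ 2) = Real.pi ^ ((n : ℝ) / 2) := by
    have := GaussianFourier.integral_rexp_neg_mul_sq_norm (V := 𝔼 n) (b := 1) one_pos
    simpa using this
  set I := Real.pi ^ ((n : ℝ) / 2) with hIdef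
  have hI0 : 0 < I := by positivity
  have hint : Integrable fun x : 𝔼 n => Real.exp (-‖x‖ ^ 2) :=
    Integrable.of_integral_ne_zero (by rw [hI]; exact hI0.ne')
  have hn1 : ((n - 1 : ℕ) : ℝ) = (n : ℝ) - 1 := by
    rw [Nat.cast_sub (Nat.one_le_iff_ne_zero.2 hn)]; simp
  have hsq : ∀ τ : ℝ, 0 ≤ τ → (1 + τ) ^ (-((n : ℝ) - 1) / 2) = (Real.sqrt (1 + τ) ^ (n - 1))⁻¹ := by
    intro τ hτ
    rw [Real.sqrt_eq_rpow, ← Real.rpow_natCast, ← Real.rpow_mul (by positivity),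
      ← Real.rpow_neg (by positivity), hn1]
    congr 1; ring
  refine ⟨V * 3 ^ (n - 1) + I * Real.exp 1 * 4 ^ (n - 1), by positivity, fun τ θ hτ => ?_⟩
  rw [hsq τ hτ]
  set J := ∫⁻ ω : 𝕊 n, ENNReal.ofReal (Real.exp (-(τ * ‖(θ : 𝔼 n) - ω‖ ^ 2))) ∂sphereMeasure n
  rcases lt_or_ge τ 4 with h4 | h4
  · have hs : Real.sqrt (1 + τ) ≤ 3 := by rw [Real.sqrt_le_left (by norm_num)]; linarith
    have hs0 : 0 < Real.sqrt (1 + τ) := by positivity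
    calc J ≤ ∫⁻ ω : 𝕊 n, 1 ∂sphereMeasure n := by
          refine lintegral_mono fun ω => ?_
          rw [← ENNReal.ofReal_one]
          refine ENNReal.ofReal_le_ofReal (Real.exp_le_one_iff.2 ?_)
          have : 0 ≤ τ * ‖(θ : 𝔼 n) - ω‖ ^ 2 := by positivity
          linarith
      _ = ENNReal.ofReal V := by
          rw [lintegral_one, hV, Measure.real, ENNReal.ofReal_toReal (measure_ne_top _ _)]
      _ ≤ _ := by
          refine ENNReal.ofReal_le_ofReal ?_
          rw [← div_eq_mul_inv, le_div_iff₀ (by positivity)]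
          calc V * Real.sqrt (1 + τ) ^ (n - 1) ≤ V * 3 ^ (n - 1) := by gcongr
            _ ≤ _ := le_add_of_nonneg_right (by positivity)
  · set R := Real.sqrt τ with hR
    have hR2 : R ^ 2 = τ := Real.sq_sqrt hτ
    have hRge : 2 ≤ R := by rw [hR, Real.le_sqrt' (by norm_num)]; linarith
    have hs : Real.sqrt (1 + τ) ≤ 2 * R := by
      rw [Real.sqrt_le_left (by positivity)]; nlinarith
    have hs0 : 0 < Real.sqrt (1 + τ) := by positivity
    set c := (R / 2) ^ (n - 1) * Real.exp (-1) with hc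
    have hc0 : 0 < c := by positivity
    have hle : ENNReal.ofReal c * J ≤ ENNReal.ofReal I := by
      calc ENNReal.ofReal c * J
          = ∫⁻ s in Ioc (R - 1) R, ENNReal.ofReal c * J := by
            rw [setLIntegral_const, Real.volume_Ioc]; simp
        _ ≤ ∫⁻ s in Ioc (R - 1) R, ENNReal.ofReal (s ^ (n - 1)) *
              ∫⁻ ω : 𝕊 n, ENNReal.ofReal (Real.exp (-‖R • (θ : 𝔼 n) - s • (ω : 𝔼 n)‖ ^ 2))
                ∂sphereMeasure n := by
            refine setLIntegral_mono' measurableSet_Ioc fun s hs => ?_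
            rw [hc, ENNReal.ofReal_mul (by positivity), mul_assoc]
            have hs1 : R / 2 ≤ s := by linarith [hs.1]
            gcongr
            rw [← lintegral_const_mul' _ _ ENNReal.ofReal_ne_top]
            refine lintegral_mono fun ω => ?_
            rw [← ENNReal.ofReal_mul (by positivity), ← Real.exp_add]
            refine ENNReal.ofReal_le_ofReal (Real.exp_le_exp.2 ?_)
            rw [norm_smul_sub_smul_sq (by simp) (by simp)]
            have h1 : (R - s) ^ 2 ≤ 1 := by nlinarith [hs.1, hs.2]
            have h2 : R * s ≤ τ := by nlinarith [hs.2]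
            have h3 := mul_le_mul_of_nonneg_right h2 (sq_nonneg ‖(θ : 𝔼 n) - ω‖)
            linarith
        _ ≤ ∫⁻ s in Ioi (0 : ℝ), ENNReal.ofReal (s ^ (n - 1)) *
              ∫⁻ ω : 𝕊 n, ENNReal.ofReal (Real.exp (-‖R • (θ : 𝔼 n) - s • (ω : 𝔼 n)‖ ^ 2))
                ∂sphereMeasure n :=
            lintegral_mono_set fun s hs => by
              have := hs.1
              simp only [mem_Ioi]; linarith
        _ = ∫⁻ y, ENNReal.ofReal (Real.exp (-‖R • (θ : 𝔼 n) - y‖ ^ 2)) :=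
            (lintegral_polar n (f := fun y : 𝔼 n =>
              ENNReal.ofReal (Real.exp (-‖R • (θ : 𝔼 n) - y‖ ^ 2))) (by fun_prop) hn).symm
        _ = ∫⁻ y : 𝔼 n, ENNReal.ofReal (Real.exp (-‖y‖ ^ 2)) :=
            lintegral_sub_left_eq_self (fun y : 𝔼 n => ENNReal.ofReal (Real.exp (-‖y‖ ^ 2))) _
        _ = ENNReal.ofReal I := by
            rw [← ofReal_integral_eq_lintegral_ofReal hint (ae_of_all _ fun x => by positivity), hI]
    calc J ≤ ENNReal.ofReal (I / c) := by
          rw [ENNReal.ofReal_div_of_pos hc0, ENNReal.le_div_iff_mul_le (by simp [hc0]) (by simp),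
            mul_comm]
          exact hle
      _ ≤ _ := by
          refine ENNReal.ofReal_le_ofReal ?_
          have h5 : (Real.sqrt (1 + τ)) ^ (n - 1) ≤ 4 ^ (n - 1) * (R / 2) ^ (n - 1) := by
            rw [← mul_pow]; gcongr; linarith
          rw [← div_eq_mul_inv, div_le_div_iff₀ hc0 (by positivity), hc]
          calc I * Real.sqrt (1 + τ) ^ (n - 1) ≤ I * (4 ^ (n - 1) * (R / 2) ^ (n - 1)) := by gcongr
            _ = (I * Real.exp 1 * 4 ^ (n - 1)) * ((R / 2) ^ (n - 1) * Real.exp (-1)) := by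
              rw [Real.exp_neg]; field_simp
            _ ≤ _ := by
              gcongr
              exact le_add_of_nonneg_left (by positivity)

/-- The `L^q` norm of `φ` on `(0,∞)`, with the supremum for `q = ∞`. -/
def radialNorm (q : ℝ≥0∞) (φ : ℝ → ℝ≥0∞) : ℝ≥0∞ :=
  if q = ∞ then ⨆ ρ ∈ Ioi (0 : ℝ), φ ρ
  else (∫⁻ ρ in Ioi (0 : ℝ), φ ρ ^ q.toReal) ^ (1 / q.toReal)

/-- The weight `(ρ / (1 + ρ)) ^ s`. -/
def radialWeight (s ρ : ℝ) : ℝ≥0∞ := ENNReal.ofReal ((ρ / (1 + ρ)) ^ s)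

/-- The Gaussian kernel `exp (-(ρ - σ)² / 16)`. -/
def radialGauss (ρ σ : ℝ) : ℝ≥0∞ := ENNReal.ofReal (Real.exp (-((ρ - σ) ^ 2 / 16)))

theorem radialNorm_mono {q : ℝ≥0∞} {φ ψ : ℝ → ℝ≥0∞} (h : ∀ ρ, 0 < ρ → φ ρ ≤ ψ ρ) :
    radialNorm q φ ≤ radialNorm q ψ := by
  unfold radialNorm
  split_ifs
  · exact iSup₂_mono h
  · gcongr 1
    exact setLIntegral_mono' measurableSet_Ioi fun ρ hρ => by gcongr; exact h ρ hρ

theorem radialNorm_const_mul {q : ℝ≥0∞} (hq : 1 ≤ q) {c : ℝ≥0∞} (hc : c ≠ ∞) (φ : ℝ → ℝ≥0∞) :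
    radialNorm q (fun ρ => c * φ ρ) = c * radialNorm q φ := by
  unfold radialNorm
  split_ifs with h
  · simp_rw [ENNReal.mul_iSup]
  · have hq0 : 0 < q.toReal := ENNReal.toReal_pos (zero_lt_one.trans_le hq).ne' h
    simp_rw [ENNReal.mul_rpow_of_nonneg _ _ hq0.le]
    rw [lintegral_const_mul' _ _ (ENNReal.rpow_ne_top_of_nonneg hq0.le hc),
      ENNReal.mul_rpow_of_nonneg _ _ (by positivity), ← ENNReal.rpow_mul,
      mul_one_div_cancel hq0.ne', ENNReal.rpow_one]

@[fun_prop]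
theorem measurable_radialWeight (s : ℝ) : Measurable (radialWeight s) := by
  unfold radialWeight; fun_prop

theorem measurable_uncurry_radialGauss : Measurable (Function.uncurry radialGauss) := by
  unfold radialGauss Function.uncurry; fun_prop

@[fun_prop]
theorem measurable_radialGauss (ρ : ℝ) : Measurable (radialGauss ρ) := by
  unfold radialGauss; fun_prop

theorem radialGauss_comm (ρ σ : ℝ) : radialGauss ρ σ = radialGauss σ ρ := by
  unfold radialGauss; congr 4; ring

theorem radialGauss_le_one (ρ σ : ℝ) : radialGauss ρ σ ≤ 1 := by
  unfold radialGauss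
  rw [← ENNReal.ofReal_one]
  refine ENNReal.ofReal_le_ofReal (Real.exp_le_one_iff.2 ?_)
  have : 0 ≤ (ρ - σ) ^ 2 := sq_nonneg _
  linarith

theorem radialWeight_rpow {s t ρ : ℝ} (hρ : 0 < ρ) :
    radialWeight s ρ ^ t = radialWeight (s * t) ρ := by
  unfold radialWeight
  rw [ENNReal.ofReal_rpow_of_pos (by positivity), Real.rpow_mul (by positivity)]

theorem radialWeight_anti {s t ρ : ℝ} (hρ : 0 < ρ) (hst : s ≤ t) :
    radialWeight t ρ ≤ radialWeight s ρ :=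
  ENNReal.ofReal_le_ofReal (Real.rpow_le_rpow_of_exponent_ge (by positivity)
    (by rw [div_le_one (by positivity)]; linarith) hst)

theorem radialWeight_le_one {s ρ : ℝ} (hρ : 0 < ρ) (hs : 0 ≤ s) : radialWeight s ρ ≤ 1 := by
  simpa [radialWeight] using radialWeight_anti hρ hs

theorem lintegral_radialGauss_lt_top (σ : ℝ) :
    ∫⁻ ρ, radialGauss ρ σ = ∫⁻ ρ, radialGauss ρ 0 ∧ ∫⁻ ρ, radialGauss ρ 0 < ∞ := by
  constructor
  · simpa [radialGauss] using lintegral_sub_right_eq_self (fun ρ => radialGauss ρ 0) (μ := volume) σ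
  · have h := (integrable_exp_neg_mul_sq (b := 1 / 16) (by norm_num)).lintegral_lt_top
    refine lt_of_eq_of_lt (lintegral_congr fun ρ => ?_) h
    unfold radialGauss
    congr 2; ring

theorem lintegral_radialGauss_mul_radialWeight_le {s : ℝ} (hs : -1 < s) :
    ∃ C : ℝ, 0 < C ∧ ∀ σ,
      ∫⁻ ρ in Ioi (0 : ℝ), radialGauss ρ σ * radialWeight s ρ ≤ ENNReal.ofReal C := by
  set t := min s 0 with ht
  have ht1 : -1 < t := lt_min hs (by norm_num)
  have ht0 : t ≤ 0 := min_le_right _ _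
  set I₁ := ∫⁻ ρ, radialGauss ρ 0 with hI₁
  have hI₁t : I₁ < ∞ := (lintegral_radialGauss_lt_top 0).2
  set I₂ := ∫⁻ ρ in Ioc (0 : ℝ) 1, ENNReal.ofReal (ρ ^ t) with hI₂
  have hI₂t : I₂ < ∞ := by
    have h := (intervalIntegral.intervalIntegrable_rpow' ht1 (a := 0) (b := 1)).1
    exact h.lintegral_lt_top
  have h2 : (2 : ℝ) ^ (-t) ≤ 2 := by
    calc (2 : ℝ) ^ (-t) ≤ 2 ^ (1 : ℝ) :=
          Real.rpow_le_rpow_of_exponent_le (by norm_num) (by linarith)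
      _ = 2 := by norm_num
  have hpt : ∀ ρ : ℝ, 0 < ρ → ∀ σ, radialGauss ρ σ * radialWeight s ρ ≤
      2 * radialGauss ρ σ + (Ioc (0 : ℝ) 1).indicator (fun ρ => 2 * ENNReal.ofReal (ρ ^ t)) ρ := by
    intro ρ hρ σ
    have hst := radialWeight_anti hρ (min_le_left s 0)
    rcases le_total ρ 1 with h1 | h1
    · rw [indicator_of_mem (show ρ ∈ Ioc (0 : ℝ) 1 from ⟨hρ, h1⟩)]
      have : radialWeight t ρ ≤ 2 * ENNReal.ofReal (ρ ^ t) := by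
        unfold radialWeight
        rw [← ENNReal.ofReal_ofNat, ← ENNReal.ofReal_mul (by norm_num)]
        refine ENNReal.ofReal_le_ofReal ?_
        calc (ρ / (1 + ρ)) ^ t ≤ (ρ / 2) ^ t :=
              Real.rpow_le_rpow_of_nonpos (by positivity)
                (div_le_div_of_nonneg_left hρ.le (by positivity) (by linarith)) ht0
          _ = 2 ^ (-t) * ρ ^ t := by
              rw [Real.div_rpow hρ.le (by norm_num), Real.rpow_neg (by norm_num)]
              field_simp
          _ ≤ 2 * ρ ^ t := by gcongr
      calc radialGauss ρ σ * radialWeight s ρ ≤ 1 * (2 * ENNReal.ofReal (ρ ^ t)) := by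
            gcongr
            · exact radialGauss_le_one _ _
            · exact hst.trans this
        _ ≤ _ := by rw [one_mul]; exact le_add_self
    · have : radialWeight t ρ ≤ 2 := by
        unfold radialWeight
        rw [← ENNReal.ofReal_ofNat]
        refine ENNReal.ofReal_le_ofReal ?_
        calc (ρ / (1 + ρ)) ^ t ≤ (1 / 2) ^ t :=
              Real.rpow_le_rpow_of_nonpos (by positivity)
                (by rw [div_le_div_iff₀ (by positivity) (by positivity)]; linarith) ht0
          _ = 2 ^ (-t) := by
              rw [one_div, Real.inv_rpow (by norm_num), Real.rpow_neg (by norm_num)]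
          _ ≤ 2 := h2
      calc radialGauss ρ σ * radialWeight s ρ ≤ radialGauss ρ σ * 2 := by
            gcongr; exact hst.trans this
        _ ≤ _ := by rw [mul_comm]; exact le_self_add
  have hfin : 2 * I₁ + 2 * I₂ ≠ ∞ :=
    ENNReal.add_ne_top.2 ⟨ENNReal.mul_ne_top (by simp) hI₁t.ne, ENNReal.mul_ne_top (by simp) hI₂t.ne⟩
  refine ⟨(2 * I₁ + 2 * I₂).toReal + 1, by positivity, fun σ => ?_⟩
  calc ∫⁻ ρ in Ioi (0 : ℝ), radialGauss ρ σ * radialWeight s ρ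
      ≤ ∫⁻ ρ in Ioi (0 : ℝ), (2 * radialGauss ρ σ +
          (Ioc (0 : ℝ) 1).indicator (fun ρ => 2 * ENNReal.ofReal (ρ ^ t)) ρ) :=
        setLIntegral_mono' measurableSet_Ioi fun ρ hρ => hpt ρ hρ σ
    _ ≤ ∫⁻ ρ, (2 * radialGauss ρ σ +
          (Ioc (0 : ℝ) 1).indicator (fun ρ => 2 * ENNReal.ofReal (ρ ^ t)) ρ) :=
        setLIntegral_le_lintegral _ _
    _ = 2 * I₁ + 2 * I₂ := by
        simp_rw [radialGauss_comm _ σ]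
        rw [lintegral_add_left (by fun_prop), lintegral_const_mul _ (by fun_prop),
          lintegral_indicator measurableSet_Ioc, lintegral_const_mul _ (by fun_prop)]
        simp_rw [radialGauss_comm σ]
        rw [(lintegral_radialGauss_lt_top σ).1]
    _ ≤ _ := by
        rw [ENNReal.ofReal_add (by positivity) zero_le_one, ENNReal.ofReal_toReal hfin]
        exact le_self_add

theorem lintegral_radialGauss_mul_le_of_lt_top {p : ℝ} (hp : 1 ≤ p) {b : ℝ}
    (hb : -(1 - 1 / p) < b) :
    ∃ C : ℝ, 0 < C ∧ ∀ g : ℝ → ℝ≥0∞, Measurable g → ∀ ρ,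
      ∫⁻ σ in Ioi (0 : ℝ), radialGauss ρ σ * (radialWeight b σ * g σ) ≤
        ENNReal.ofReal C * (∫⁻ σ in Ioi (0 : ℝ), radialGauss ρ σ * g σ ^ p) ^ (1 / p) := by
  rcases hp.eq_or_lt with rfl | hp1
  · refine ⟨1, one_pos, fun g hg ρ => ?_⟩
    simp only [ofReal_one, one_mul, ENNReal.rpow_one, div_one]
    refine setLIntegral_mono' measurableSet_Ioi fun σ hσ => ?_
    gcongr
    exact mul_le_of_le_one_left' (radialWeight_le_one hσ (by norm_num at hb; exact hb.le))
  · have hp0 : 0 < p := by linarith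
    set p' := p / (p - 1) with hp'
    have hconj : p'.HolderConjugate p := (Real.HolderConjugate.conjExponent hp1).symm
    have hp'0 : 0 < p' := hconj.pos
    have hbp : -1 < b * p' := by
      have h1 : (1 - 1 / p) * p' = 1 := by
        rw [hp']; field_simp [(sub_pos.2 hp1).ne']
      have := mul_lt_mul_of_pos_right hb hp'0
      rw [neg_mul, h1] at this
      exact this
    obtain ⟨C, hC, hle⟩ := lintegral_radialGauss_mul_radialWeight_le hbp
    refine ⟨C ^ (1 / p'), by positivity, fun g hg ρ => ?_⟩
    have hk := measurable_radialGauss ρ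
    have h := ENNReal.lintegral_mul_le_Lp_mul_Lq
      ((volume.restrict (Ioi (0 : ℝ))).withDensity (radialGauss ρ)) hconj
      (f := radialWeight b) (g := g) (measurable_radialWeight b).aemeasurable hg.aemeasurable
    rw [lintegral_withDensity_eq_lintegral_mul _ hk ((measurable_radialWeight b).mul hg),
      lintegral_withDensity_eq_lintegral_mul _ hk (hg.pow_const p),
      lintegral_withDensity_eq_lintegral_mul _ hk ((measurable_radialWeight b).pow_const _)] at h
    simp only [Pi.mul_apply] at h
    refine h.trans ?_
    rw [← ENNReal.ofReal_rpow_of_pos hC]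
    gcongr ?_ * _
    refine ENNReal.rpow_le_rpow ?_ (by positivity)
    refine le_trans (setLIntegral_mono' measurableSet_Ioi fun σ hσ => ?_) (hle ρ)
    rw [radialWeight_rpow hσ, radialGauss_comm]

theorem radialNorm_radialGauss_le {p q : ℝ≥0∞} (hp : 1 ≤ p) (hpq : p ≤ q) {a b : ℝ}
    (ha : -(q⁻¹).toReal < a) (hb : -(1 - (p⁻¹).toReal) < b) :
    ∃ C : ℝ, 0 < C ∧ ∀ g : ℝ → ℝ≥0∞, Measurable g →
      radialNorm q (fun ρ => radialWeight a ρ *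
          ∫⁻ σ in Ioi (0 : ℝ), radialGauss ρ σ * (radialWeight b σ * g σ)) ≤
        ENNReal.ofReal C * radialNorm p g := by
  have hq : 1 ≤ q := hp.trans hpq
  rcases eq_or_ne p ∞ with rfl | hpt
  · obtain rfl : q = ∞ := top_le_iff.1 hpq
    simp only [inv_top, toReal_zero, sub_zero, neg_zero] at ha hb
    obtain ⟨C, hC, hle⟩ := lintegral_radialGauss_mul_radialWeight_le hb
    refine ⟨C, hC, fun g hg => ?_⟩
    simp only [radialNorm, if_true]
    refine iSup₂_le fun ρ hρ => ?_
    set S := ⨆ ρ ∈ Ioi (0 : ℝ), g ρ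
    calc radialWeight a ρ * ∫⁻ σ in Ioi (0 : ℝ), radialGauss ρ σ * (radialWeight b σ * g σ)
        ≤ 1 * ∫⁻ σ in Ioi (0 : ℝ), radialGauss σ ρ * radialWeight b σ * S := by
          gcongr ?_ * ?_
          · exact radialWeight_le_one hρ ha.le
          · refine setLIntegral_mono' measurableSet_Ioi fun σ hσ => ?_
            rw [radialGauss_comm, mul_assoc]
            gcongr
            exact le_iSup₂ (f := fun ρ (_ : ρ ∈ Ioi (0 : ℝ)) => g ρ) σ hσ
      _ = (∫⁻ σ in Ioi (0 : ℝ), radialGauss σ ρ * radialWeight b σ) * S := by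
          simp_rw [radialGauss_comm _ ρ]
          rw [one_mul, lintegral_mul_const _ (by fun_prop)]
      _ ≤ _ := by gcongr; exact hle ρ
  have hp1 : 1 ≤ p.toReal := by
    rw [← ENNReal.toReal_one]; exact ENNReal.toReal_mono hpt hp
  have hp0 : 0 < p.toReal := by linarith
  rw [ENNReal.toReal_inv, ← one_div] at hb
  obtain ⟨C₁, hC₁, h₁⟩ := lintegral_radialGauss_mul_le_of_lt_top hp1 hb
  rcases eq_or_ne q ∞ with rfl | hqt
  · simp only [inv_top, toReal_zero, neg_zero] at ha
    refine ⟨C₁, hC₁, fun g hg => ?_⟩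
    simp only [radialNorm, if_true, if_neg hpt]
    refine iSup₂_le fun ρ hρ => ?_
    calc _ ≤ 1 * (ENNReal.ofReal C₁ *
          (∫⁻ σ in Ioi (0 : ℝ), radialGauss ρ σ * g σ ^ p.toReal) ^ (1 / p.toReal)) := by
          gcongr ?_ * ?_
          · exact radialWeight_le_one hρ ha.le
          · exact h₁ g hg ρ
      _ ≤ _ := by
          rw [one_mul]
          gcongr with σ
          exact mul_le_of_le_one_left' (radialGauss_le_one _ _)
  · have hpq' : p.toReal ≤ q.toReal := ENNReal.toReal_mono hqt hpq
    have hq0 : 0 < q.toReal := by linarith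
    have haq : -1 < a * q.toReal := by
      rw [ENNReal.toReal_inv] at ha
      have := mul_lt_mul_of_pos_right ha hq0
      rwa [neg_mul, inv_mul_cancel₀ hq0.ne'] at this
    obtain ⟨C₂, hC₂, h₂⟩ := lintegral_radialGauss_mul_radialWeight_le haq
    refine ⟨C₁ * C₂ ^ (1 / q.toReal), by positivity, fun g hg => ?_⟩
    have hmain := lintegral_mul_rpow_kernel_le (μ := volume.restrict (Ioi (0 : ℝ)))
      (ν := volume.restrict (Ioi (0 : ℝ))) measurable_uncurry_radialGauss
      (measurable_radialWeight a) hg hp1 hpq' (A := ENNReal.ofReal C₂) (B := 1)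
      radialGauss_le_one (fun σ => by
        refine le_trans (setLIntegral_mono' measurableSet_Ioi fun ρ hρ => ?_) (h₂ σ)
        rw [radialWeight_rpow hρ])
    calc _ ≤ radialNorm q (fun ρ => ENNReal.ofReal C₁ * (radialWeight a ρ *
            (∫⁻ σ in Ioi (0 : ℝ), radialGauss ρ σ * g σ ^ p.toReal) ^ (1 / p.toReal))) := by
          refine radialNorm_mono fun ρ _ => ?_
          rw [mul_left_comm]
          gcongr
          exact h₁ g hg ρ
      _ = ENNReal.ofReal C₁ * radialNorm q (fun ρ => radialWeight a ρ *
            (∫⁻ σ in Ioi (0 : ℝ), radialGauss ρ σ * g σ ^ p.toReal) ^ (1 / p.toReal)) :=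
          radialNorm_const_mul hq ENNReal.ofReal_ne_top _
      _ ≤ ENNReal.ofReal C₁ * (ENNReal.ofReal C₂ ^ (1 / q.toReal) * radialNorm p g) := by
          simp only [radialNorm, if_neg hpt, if_neg hqt]
          gcongr
          calc _ ≤ _ := ENNReal.rpow_le_rpow hmain (by positivity)
            _ = _ := by
              rw [ENNReal.one_rpow, mul_one, ENNReal.mul_rpow_of_nonneg _ _ (by positivity),
                ← ENNReal.rpow_mul]
              congr 2
              field_simp
      _ = _ := by
          rw [ENNReal.ofReal_mul hC₁.le, ← ENNReal.ofReal_rpow_of_pos hC₂, mul_assoc]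

/-- Pointwise domination of the kernel obtained after integrating out the angular variables. -/
theorem rpow_mul_rpow_mul_exp_le {a b m : ℝ} (hm : 0 ≤ m) (h : a + b ≤ 2 * m) :
    ∃ C : ℝ, 0 < C ∧ ∀ ρ σ : ℝ, 0 < ρ → 0 < σ →
      ρ ^ a * σ ^ b * (Real.exp (-((ρ - σ) ^ 2 / 8)) * (1 + ρ * σ) ^ (-m)) ≤
        C * ((ρ / (1 + ρ)) ^ a * (σ / (1 + σ)) ^ b * Real.exp (-((ρ - σ) ^ 2 / 16))) := by
  obtain ⟨k, hk⟩ := exists_nat_ge (|b| + 2 * m)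
  obtain ⟨C, hC, hle⟩ := one_add_pow_mul_exp_neg_sq_le k (c := 1 / 16) (by norm_num)
  refine ⟨4 ^ m * C, by positivity, fun ρ σ hρ hσ => ?_⟩
  set d := |ρ - σ| with hd
  have hd0 : 0 ≤ d := abs_nonneg _
  have hd2 : d ^ 2 = (ρ - σ) ^ 2 := sq_abs _
  have hρσ := mul_pos hρ hσ
  have hb1 : (1 + σ) ^ b ≤ (1 + ρ) ^ b * (1 + d) ^ |b| := by
    rcases le_total 0 b with h0 | h0
    · rw [abs_of_nonneg h0, ← Real.mul_rpow (by positivity) (by positivity)]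
      refine Real.rpow_le_rpow (by positivity) ?_ h0
      have := neg_abs_le (ρ - σ)
      nlinarith [mul_nonneg hρ.le hd0]
    · rw [abs_of_nonpos h0, Real.rpow_neg (by positivity), ← Real.inv_rpow (by positivity),
        ← Real.mul_rpow (by positivity) (by positivity)]
      refine Real.rpow_le_rpow_of_nonpos (by positivity) ?_ h0
      rw [← div_eq_mul_inv, div_le_iff₀ (by positivity)]
      have := le_abs_self (ρ - σ)
      nlinarith [mul_nonneg hσ.le hd0]
  have hm1 : (1 + ρ * σ) ^ (-m) ≤ 4 ^ m * ((1 + d) ^ (2 * m) * (1 + ρ) ^ (-(2 * m))) := by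
    have h2 : ∀ x : ℝ, 0 < x → x ^ (2 * m) = (x ^ 2) ^ m := fun x hx => by
      rw [Real.rpow_mul hx.le]; norm_num
    rw [Real.rpow_neg (by positivity), Real.rpow_neg (by positivity), h2 _ (by positivity),
      h2 _ (by positivity), ← Real.inv_rpow (by positivity), ← Real.inv_rpow (by positivity),
      ← Real.mul_rpow (by positivity) (by positivity),
      ← Real.mul_rpow (by positivity) (by positivity)]
    refine Real.rpow_le_rpow (by positivity) ?_ hm
    rw [← mul_assoc, ← div_eq_mul_inv, inv_eq_one_div, div_le_div_iff₀ (by positivity)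
      (by positivity)]
    have h3 : (1 + ρ) ^ 2 ≤ 2 * (1 + ρ ^ 2) := by nlinarith [sq_nonneg (ρ - 1)]
    have h4 : ρ ^ 2 ≤ 2 * (ρ * σ) + 2 * d ^ 2 := by rw [hd2]; nlinarith [sq_nonneg (ρ - 2 * σ)]
    nlinarith [mul_nonneg hd0 hρσ.le, mul_nonneg (sq_nonneg d) hρσ.le, sq_nonneg d]
  have hexp : (1 + d) ^ (|b| + 2 * m) * Real.exp (-((ρ - σ) ^ 2 / 8)) ≤
      C * Real.exp (-((ρ - σ) ^ 2 / 16)) := by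
    have h5 : Real.exp (-((ρ - σ) ^ 2 / 8)) =
        Real.exp (-(1 / 16 * d ^ 2)) * Real.exp (-((ρ - σ) ^ 2 / 16)) := by
      rw [← Real.exp_add, hd2]; congr 1; ring
    rw [h5, ← mul_assoc]
    gcongr
    refine le_trans ?_ (hle d hd0)
    gcongr
    rw [← Real.rpow_natCast]
    exact Real.rpow_le_rpow_of_exponent_le (by linarith) hk
  rw [Real.div_rpow hρ.le (by positivity), Real.div_rpow hσ.le (by positivity)]
  have hρa : (1 + ρ) ^ a * (1 + ρ) ^ b * (1 + ρ) ^ (-(2 * m)) ≤ 1 := by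
    rw [← Real.rpow_add (by positivity), ← Real.rpow_add (by positivity)]
    exact Real.rpow_le_one_of_one_le_of_nonpos (by linarith) (by linarith)
  have hA : 0 < (1 + ρ) ^ a := by positivity
  have hB : 0 < (1 + σ) ^ b := by positivity
  have key : (1 + ρ) ^ a * (1 + σ) ^ b *
      (Real.exp (-((ρ - σ) ^ 2 / 8)) * (1 + ρ * σ) ^ (-m)) ≤
        4 ^ m * C * Real.exp (-((ρ - σ) ^ 2 / 16)) := by
    calc _ ≤ (1 + ρ) ^ a * ((1 + ρ) ^ b * (1 + d) ^ |b|) * (Real.exp (-((ρ - σ) ^ 2 / 8)) *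
          (4 ^ m * ((1 + d) ^ (2 * m) * (1 + ρ) ^ (-(2 * m))))) := by gcongr
      _ = ((1 + ρ) ^ a * (1 + ρ) ^ b * (1 + ρ) ^ (-(2 * m))) *
          (4 ^ m * ((1 + d) ^ (|b| + 2 * m) * Real.exp (-((ρ - σ) ^ 2 / 8)))) := by
          rw [Real.rpow_add (by positivity)]; ring
      _ ≤ 1 * (4 ^ m * (C * Real.exp (-((ρ - σ) ^ 2 / 16)))) := by gcongr
      _ = _ := by ring
  calc _ = ρ ^ a / (1 + ρ) ^ a * (σ ^ b / (1 + σ) ^ b) * ((1 + ρ) ^ a * (1 + σ) ^ b *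
      (Real.exp (-((ρ - σ) ^ 2 / 8)) * (1 + ρ * σ) ^ (-m))) := by field_simp
    _ ≤ ρ ^ a / (1 + ρ) ^ a * (σ ^ b / (1 + σ) ^ b) *
      (4 ^ m * C * Real.exp (-((ρ - σ) ^ 2 / 16))) := by gcongr
    _ = _ := by ring

theorem eLpNorm_le_ofReal_mul {X ε ε' : Type*} [MeasurableSpace X] [TopologicalSpace ε]
    [ContinuousENorm ε] [TopologicalSpace ε'] [ContinuousENorm ε'] {μ : Measure X}
    {f : X → ε} {g : X → ε'} {c : ℝ} (h : ∀ x, ‖f x‖ₑ ≤ ENNReal.ofReal c * ‖g x‖ₑ) (p : ℝ≥0∞) :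
    eLpNorm f p μ ≤ ENNReal.ofReal c * eLpNorm g p μ :=
  eLpNorm_le_nnreal_smul_eLpNorm_of_ae_le_mul' (ae_of_all μ h) p

theorem radialNorm_comp_mul_left {q : ℝ≥0∞} (hq : 1 ≤ q) {s : ℝ} (hs : 0 < s)
    (φ : ℝ → ℝ≥0∞) :
    radialNorm q (fun ρ => φ (s * ρ)) = ENNReal.ofReal (s ^ (-(q⁻¹).toReal)) * radialNorm q φ := by
  unfold radialNorm
  split_ifs with h
  · rw [h]
    simp only [inv_top, toReal_zero, neg_zero, Real.rpow_zero, ofReal_one, one_mul]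
    refine le_antisymm (iSup₂_le fun ρ hρ => ?_) (iSup₂_le fun ρ hρ => ?_)
    · exact le_iSup₂ (f := fun ρ (_ : ρ ∈ Ioi (0 : ℝ)) => φ ρ) (s * ρ) (mul_pos hs hρ)
    · have := le_iSup₂ (f := fun ρ (_ : ρ ∈ Ioi (0 : ℝ)) => φ (s * ρ)) (s⁻¹ * ρ)
        (mul_pos (inv_pos.2 hs) hρ)
      rwa [mul_inv_cancel_left₀ hs.ne'] at this
  · have hq0 : 0 < q.toReal := ENNReal.toReal_pos (zero_lt_one.trans_le hq).ne' h
    have hint : ∫⁻ ρ in Ioi (0 : ℝ), φ (s * ρ) ^ q.toReal =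
        ENNReal.ofReal s⁻¹ * ∫⁻ ρ in Ioi (0 : ℝ), φ ρ ^ q.toReal := by
      rw [← lintegral_indicator measurableSet_Ioi, ← lintegral_indicator measurableSet_Ioi]
      have hm := (measurableEmbedding_mulLeft₀ hs.ne').lintegral_map (μ := (volume : Measure ℝ))
        ((Ioi (0 : ℝ)).indicator fun ρ => φ ρ ^ q.toReal)
      rw [Real.map_volume_mul_left hs.ne', lintegral_smul_measure,
        abs_of_pos (inv_pos.2 hs)] at hm
      rw [← smul_eq_mul, hm]
      refine lintegral_congr fun ρ => ?_
      simp only [indicator, mem_Ioi, mul_pos_iff_of_pos_left hs]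
    rw [hint, ENNReal.mul_rpow_of_nonneg _ _ (by positivity),
      ENNReal.ofReal_rpow_of_pos (inv_pos.2 hs), ENNReal.toReal_inv, Real.inv_rpow hs.le,
      ← Real.rpow_neg hs.le, one_div]

theorem mixedNorm_rpow_mul_eq_radialNorm {n : ℕ} (hn : n ≠ 0) {p : ℝ≥0∞} (hp : 1 ≤ p)
    (pt : ℝ≥0∞) (α : ℝ) (u : (𝔼 n) → ℝ) :
    mixedNorm n p pt (fun x => ‖x‖ ^ α * u x) = radialNorm p fun ρ =>
      ENNReal.ofReal (ρ ^ (((n : ℝ) - 1) * (p⁻¹).toReal + α)) * angNorm n pt u ρ := by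
  have hang : ∀ ρ : ℝ, 0 < ρ → angNorm n pt (fun x => ‖x‖ ^ α * u x) ρ =
      ENNReal.ofReal (ρ ^ α) * angNorm n pt u ρ := fun ρ hρ => by
    unfold angNorm
    have := eLpNorm_const_smul (ρ ^ α) (fun θ : 𝕊 n => u (ρ • (θ : 𝔼 n))) pt (sphereMeasure n)
    rw [Real.enorm_of_nonneg (by positivity)] at this
    rw [← this]
    congr 1
    ext θ
    simp [norm_smul, abs_of_pos hρ]
  unfold mixedNorm radialNorm
  split_ifs with h
  · refine iSup_congr fun ρ => iSup_congr fun hρ => ?_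
    rw [hang ρ hρ, h]
    simp
  · have hp0 : 0 < p.toReal := ENNReal.toReal_pos (zero_lt_one.trans_le hp).ne' h
    congr 1
    refine setLIntegral_congr_fun measurableSet_Ioi fun ρ hρ => ?_
    have hρ : 0 < ρ := hρ
    have hn1 : ((n - 1 : ℕ) : ℝ) = (n : ℝ) - 1 := by
      rw [Nat.cast_sub (Nat.one_le_iff_ne_zero.2 hn)]; simp
    simp only
    rw [hang ρ hρ, ENNReal.mul_rpow_of_nonneg _ _ hp0.le, ENNReal.mul_rpow_of_nonneg _ _ hp0.le,
      mul_right_comm, ENNReal.ofReal_rpow_of_pos (by positivity),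
      ENNReal.ofReal_rpow_of_pos (by positivity), ← ENNReal.ofReal_mul (by positivity),
      ← Real.rpow_mul hρ.le, ← Real.rpow_mul hρ.le, ← Real.rpow_natCast, ← Real.rpow_add hρ, hn1,
      ENNReal.toReal_inv]
    congr 3
    field_simp
    ring

/-- The angular `L^{p̃} → L^{q̃}` bound for the Gaussian convolution, in polar coordinates. -/
theorem eLpNorm_gauss_conv_le {n : ℕ} (hn : n ≠ 0) {pt qt : ℝ≥0∞} (hpt : 1 ≤ pt)
    (hptqt : pt ≤ qt) :
    ∃ C : ℝ, 0 < C ∧ ∀ U : (𝔼 n) → ℝ≥0∞, Measurable U → ∀ ρ : ℝ, 0 < ρ →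
      eLpNorm (fun θ : 𝕊 n => ∫⁻ y,
          ENNReal.ofReal (Real.exp (-‖ρ • (θ : 𝔼 n) - y‖ ^ 2 / 8)) * U y) qt (sphereMeasure n) ≤
        ∫⁻ σ in Ioi (0 : ℝ), ENNReal.ofReal (C * (Real.exp (-((ρ - σ) ^ 2 / 8)) *
            (1 + ρ * σ) ^ (-(((n : ℝ) - 1) * (1 - (pt⁻¹).toReal + (qt⁻¹).toReal) / 2))) *
              σ ^ ((n : ℝ) - 1)) *
          eLpNorm (fun θ : 𝕊 n => U (σ • (θ : 𝔼 n))) pt (sphereMeasure n) := by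
  obtain ⟨C₀, hC₀, hsph⟩ := lintegral_sphere_exp_le n hn
  have hn1 : ((n - 1 : ℕ) : ℝ) = (n : ℝ) - 1 := by
    rw [Nat.cast_sub (Nat.one_le_iff_ne_zero.2 hn)]; simp
  have hn0 : (0 : ℝ) ≤ (n : ℝ) - 1 := by rw [← hn1]; positivity
  set κ := 1 - (pt⁻¹).toReal + (qt⁻¹).toReal with hκ
  have hκ0 : 0 ≤ κ := by
    have h1 : (pt⁻¹).toReal ≤ 1 := by
      rw [← ENNReal.toReal_one]
      exact ENNReal.toReal_mono (by simp) (ENNReal.inv_le_one.2 hpt)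
    have h2 : 0 ≤ (qt⁻¹).toReal := ENNReal.toReal_nonneg
    linarith
  set m := ((n : ℝ) - 1) * κ / 2 with hm
  have hm0 : 0 ≤ m := by positivity
  refine ⟨C₀ ^ κ * 8 ^ m, by positivity, fun U hU ρ hρ => ?_⟩
  have hUs : Measurable fun z : ℝ × 𝕊 n => U (z.1 • (z.2 : 𝔼 n)) := hU.comp (by fun_prop)
  set E := fun σ : ℝ => Real.exp (-((ρ - σ) ^ 2 / 8)) with hE
  have hEpos : ∀ σ, 0 < E σ := fun σ => Real.exp_pos _
  set k : ℝ → (𝕊 n) → (𝕊 n) → ℝ≥0∞ := fun σ θ ω =>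
    ENNReal.ofReal (Real.exp (-‖ρ • (θ : 𝔼 n) - σ • (ω : 𝔼 n)‖ ^ 2 / 8)) with hk
  have hkE : ∀ σ θ ω, k σ θ ω = ENNReal.ofReal (E σ) *
      ENNReal.ofReal (Real.exp (-(ρ * σ / 8 * ‖(θ : 𝔼 n) - ω‖ ^ 2))) := fun σ θ ω => by
    simp only [hk, hE]
    rw [← ENNReal.ofReal_mul (Real.exp_pos _).le, ← Real.exp_add,
      norm_smul_sub_smul_sq (by simp) (by simp)]
    congr 2; ring
  set A : ℝ → ℝ≥0∞ := fun σ => ENNReal.ofReal (E σ * (C₀ * (1 + ρ * σ / 8) ^ (-((n : ℝ) - 1) / 2)))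
    with hA
  have hkA : ∀ σ, 0 < σ → ∀ θ, ∫⁻ ω, k σ θ ω ∂sphereMeasure n ≤ A σ := fun σ hσ θ => by
    simp_rw [hkE, hA]
    rw [lintegral_const_mul' _ _ ENNReal.ofReal_ne_top, ENNReal.ofReal_mul (hEpos σ).le]
    gcongr
    exact hsph _ θ (by positivity)
  have hksymm : ∀ σ θ ω, k σ θ ω = k σ ω θ := fun σ θ ω => by
    rw [hkE, hkE, norm_sub_rev]
  have hcoef : ∀ σ, 0 < σ → A σ ^ κ * ENNReal.ofReal (E σ) ^ ((pt⁻¹).toReal - (qt⁻¹).toReal) ≤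
      ENNReal.ofReal (C₀ ^ κ * 8 ^ m * (E σ * (1 + ρ * σ) ^ (-m))) := fun σ hσ => by
    have hρσ := mul_pos hρ hσ
    rw [hA, ENNReal.ofReal_rpow_of_pos (by have := hEpos σ; positivity),
      ENNReal.ofReal_rpow_of_pos (hEpos σ), ← ENNReal.ofReal_mul (by have := hEpos σ; positivity)]
    refine ENNReal.ofReal_le_ofReal ?_
    have h1 : E σ ^ κ * E σ ^ ((pt⁻¹).toReal - (qt⁻¹).toReal) = E σ := by
      rw [← Real.rpow_add (hEpos σ), hκ]
      convert Real.rpow_one _ using 2; ring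
    have h2 : ((1 + ρ * σ / 8) ^ (-((n : ℝ) - 1) / 2)) ^ κ ≤ 8 ^ m * (1 + ρ * σ) ^ (-m) := by
      rw [← Real.rpow_mul (by positivity), show -((n : ℝ) - 1) / 2 * κ = -m by rw [hm]; ring]
      calc (1 + ρ * σ / 8) ^ (-m) ≤ ((1 + ρ * σ) / 8) ^ (-m) :=
            Real.rpow_le_rpow_of_nonpos (by positivity) (by linarith) (by linarith)
        _ = _ := by
            rw [Real.div_rpow (by positivity) (by norm_num), Real.rpow_neg (x := 8) (by norm_num),
              div_inv_eq_mul, mul_comm]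
    rw [Real.mul_rpow (hEpos σ).le (by positivity), Real.mul_rpow hC₀.le (by positivity)]
    have := hEpos σ
    calc E σ ^ κ * (C₀ ^ κ * ((1 + ρ * σ / 8) ^ (-((n : ℝ) - 1) / 2)) ^ κ) *
          E σ ^ ((pt⁻¹).toReal - (qt⁻¹).toReal)
        = C₀ ^ κ * ((1 + ρ * σ / 8) ^ (-((n : ℝ) - 1) / 2)) ^ κ *
          (E σ ^ κ * E σ ^ ((pt⁻¹).toReal - (qt⁻¹).toReal)) := by ring
      _ ≤ C₀ ^ κ * (8 ^ m * (1 + ρ * σ) ^ (-m)) * E σ := by rw [h1]; gcongr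
      _ = _ := by ring
  set f : ℝ → (𝕊 n) → ℝ≥0∞ := fun σ ω =>
    ENNReal.ofReal (σ ^ ((n : ℝ) - 1)) * U (σ • (ω : 𝔼 n)) with hf
  have hpolar : ∀ θ : 𝕊 n,
      ∫⁻ y, ENNReal.ofReal (Real.exp (-‖ρ • (θ : 𝔼 n) - y‖ ^ 2 / 8)) * U y =
        ∫⁻ σ in Ioi (0 : ℝ), ∫⁻ ω, k σ θ ω * f σ ω ∂sphereMeasure n := fun θ => by
    rw [lintegral_polar n (f := fun y => ENNReal.ofReal
      (Real.exp (-‖ρ • (θ : 𝔼 n) - y‖ ^ 2 / 8)) * U y) (by fun_prop) hn]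
    refine setLIntegral_congr_fun measurableSet_Ioi fun σ hσ => ?_
    rw [← lintegral_const_mul' _ _ ENNReal.ofReal_ne_top]
    refine lintegral_congr fun ω => ?_
    simp only [hf, hk]
    rw [← hn1, Real.rpow_natCast, mul_left_comm]
  simp_rw [hpolar]
  have hkm : Measurable fun z : ℝ × (𝕊 n) × (𝕊 n) => k z.1 z.2.1 z.2.2 := by
    simp only [hk]; fun_prop
  have hfm : Measurable (Function.uncurry f) := by
    have : Measurable fun z : ℝ × 𝕊 n => ENNReal.ofReal (z.1 ^ ((n : ℝ) - 1)) := by fun_prop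
    exact this.mul hUs
  have hae : ∀ {P : ℝ → Prop}, (∀ σ, 0 < σ → P σ) → ∀ᵐ σ ∂volume.restrict (Ioi (0 : ℝ)), P σ :=
    fun h => (ae_restrict_iff' measurableSet_Ioi).2 (ae_of_all _ h)
  refine (eLpNorm_lintegral_kernel_le (τ := volume.restrict (Ioi (0 : ℝ))) hkm hfm
    (A := A) (B := fun σ => ENNReal.ofReal (E σ)) (hae fun σ hσ θ ω => ?_)
    (hae hkA) (hae fun σ hσ ω => ?_) hpt hptqt).trans ?_
  · rw [hkE]
    refine mul_le_of_le_one_right' ?_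
    rw [← ENNReal.ofReal_one]
    refine ENNReal.ofReal_le_ofReal (Real.exp_le_one_iff.2 ?_)
    rw [neg_nonpos]; positivity
  · simp_rw [hksymm σ _ ω]; exact hkA σ hσ ω
  · refine setLIntegral_mono' measurableSet_Ioi fun σ hσ => ?_
    have hσ : 0 < σ := hσ
    refine (mul_le_mul' (hcoef σ hσ) (eLpNorm_le_ofReal_mul (c := σ ^ ((n : ℝ) - 1))
      (g := fun ω : 𝕊 n => U (σ • (ω : 𝔼 n))) (fun ω => ?_) pt)).trans_eq ?_
    · simp [hf]
    · rw [← mul_assoc, ← ENNReal.ofReal_mul (by have := hEpos σ; positivity)]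

/-- The weighted mixed-norm bound for convolution with a fixed Gaussian. -/
theorem radialNorm_gauss_conv_le {n : ℕ} (hn : n ≠ 0) {p q pt qt : ℝ≥0∞}
    (hp : 1 ≤ p) (hpq : p ≤ q) (hpt : 1 ≤ pt) (hptqt : pt ≤ qt) {α β : ℝ}
    (hβ : -((n : ℝ) * (q⁻¹).toReal) < β) (hα : α < (n : ℝ) * (1 - (p⁻¹).toReal))
    (hΛ : β + ((n : ℝ) - 1) * (q⁻¹).toReal - ((n : ℝ) - 1) * (qt⁻¹).toReal
        ≤ α + ((n : ℝ) - 1) * (p⁻¹).toReal - ((n : ℝ) - 1) * (pt⁻¹).toReal) :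
    ∃ C : ℝ, 0 < C ∧ ∀ U : (𝔼 n) → ℝ≥0∞, Measurable U →
      radialNorm q (fun ρ => ENNReal.ofReal (ρ ^ (((n : ℝ) - 1) * (q⁻¹).toReal + β)) *
        eLpNorm (fun θ : 𝕊 n => ∫⁻ y,
          ENNReal.ofReal (Real.exp (-‖ρ • (θ : 𝔼 n) - y‖ ^ 2 / 8)) * U y) qt (sphereMeasure n)) ≤
      ENNReal.ofReal C * radialNorm p (fun ρ =>
        ENNReal.ofReal (ρ ^ (((n : ℝ) - 1) * (p⁻¹).toReal + α)) *
          eLpNorm (fun θ : 𝕊 n => U (ρ • (θ : 𝔼 n))) pt (sphereMeasure n)) := by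
  have hq : 1 ≤ q := hp.trans hpq
  obtain ⟨C₁, hC₁, h₁⟩ := eLpNorm_gauss_conv_le hn hpt hptqt
  set κ := 1 - (pt⁻¹).toReal + (qt⁻¹).toReal with hκ
  have hκ0 : 0 ≤ κ := by
    have h1 : (pt⁻¹).toReal ≤ 1 := by
      rw [← ENNReal.toReal_one]
      exact ENNReal.toReal_mono (by simp) (ENNReal.inv_le_one.2 hpt)
    have h2 : 0 ≤ (qt⁻¹).toReal := ENNReal.toReal_nonneg
    linarith
  have hn0 : (0 : ℝ) ≤ (n : ℝ) - 1 := by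
    have : (1 : ℝ) ≤ n := by exact_mod_cast Nat.one_le_iff_ne_zero.2 hn
    linarith
  set a := ((n : ℝ) - 1) * (q⁻¹).toReal + β with ha
  set a' := ((n : ℝ) - 1) * (p⁻¹).toReal + α with ha'
  set b := (n : ℝ) - 1 - a' with hb
  obtain ⟨C₂, hC₂, h₂⟩ := rpow_mul_rpow_mul_exp_le (a := a) (b := b)
    (m := ((n : ℝ) - 1) * κ / 2) (by positivity) (by
      rw [hb, ha, ha', hκ]; linarith)
  obtain ⟨C₃, hC₃, h₃⟩ := radialNorm_radialGauss_le hp hpq (a := a) (b := b)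
    (by rw [ha]; linarith) (by rw [hb, ha']; linarith)
  refine ⟨C₁ * C₂ * C₃, by positivity, fun U hU => ?_⟩
  set N : ℝ → ℝ≥0∞ := fun ρ => eLpNorm (fun θ : 𝕊 n => U (ρ • (θ : 𝔼 n))) pt (sphereMeasure n)
    with hN
  have hNm : Measurable N := by
    have hUs : Measurable fun z : ℝ × 𝕊 n => U (z.1 • (z.2 : 𝔼 n)) := hU.comp (by fun_prop)
    exact measurable_eLpNorm_right hUs pt
  set g : ℝ → ℝ≥0∞ := fun σ => ENNReal.ofReal (σ ^ a') * N σ with hg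
  have hgm : Measurable g := by fun_prop
  calc _ ≤ radialNorm q (fun ρ => ENNReal.ofReal (C₁ * C₂) * (radialWeight a ρ *
          ∫⁻ σ in Ioi (0 : ℝ), radialGauss ρ σ * (radialWeight b σ * g σ))) := by
        refine radialNorm_mono fun ρ hρ => ?_
        refine (mul_le_mul_right (h₁ U hU ρ hρ) _).trans ?_
        rw [← mul_assoc, radialWeight, ← ENNReal.ofReal_mul (by positivity),
          ← lintegral_const_mul' _ _ ENNReal.ofReal_ne_top,
          ← lintegral_const_mul' _ _ ENNReal.ofReal_ne_top]
        refine setLIntegral_mono' measurableSet_Ioi fun σ hσ => ?_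
        have hσ : 0 < σ := hσ
        have hρσ := mul_pos hρ hσ
        have hgσ : g σ = ENNReal.ofReal (σ ^ a') * N σ := rfl
        rw [radialGauss, radialWeight, hgσ]
        simp only [← mul_assoc]
        rw [← ENNReal.ofReal_mul (by positivity), ← ENNReal.ofReal_mul (by positivity),
          ← ENNReal.ofReal_mul (by positivity), ← ENNReal.ofReal_mul (by positivity)]
        gcongr ENNReal.ofReal ?_ * _
        have hsplit : σ ^ ((n : ℝ) - 1) = σ ^ b * σ ^ a' := by
          rw [← Real.rpow_add hσ, hb]; congr 1; ring
        rw [hsplit]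
        calc _ = C₁ * σ ^ a' * (ρ ^ a * σ ^ b * (Real.exp (-((ρ - σ) ^ 2 / 8)) *
              (1 + ρ * σ) ^ (-(((n : ℝ) - 1) * κ / 2)))) := by ring
          _ ≤ C₁ * σ ^ a' * (C₂ * ((ρ / (1 + ρ)) ^ a * (σ / (1 + σ)) ^ b *
              Real.exp (-((ρ - σ) ^ 2 / 16)))) :=
              mul_le_mul_of_nonneg_left (h₂ ρ σ hρ hσ) (by positivity)
          _ = _ := by ring
    _ = ENNReal.ofReal (C₁ * C₂) * radialNorm q (fun ρ => radialWeight a ρ *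
          ∫⁻ σ in Ioi (0 : ℝ), radialGauss ρ σ * (radialWeight b σ * g σ)) :=
        radialNorm_const_mul hq ENNReal.ofReal_ne_top _
    _ ≤ ENNReal.ofReal (C₁ * C₂) * (ENNReal.ofReal C₃ * radialNorm p g) := by
        gcongr; exact h₃ g hgm
    _ = _ := by rw [← mul_assoc, ← ENNReal.ofReal_mul (by positivity)]

/-- The fixed-time smoothing estimate for derivatives of the heat flow. -/
theorem mixedNorm_conv_multiDeriv_heatKernel_le {n : ℕ} (hn : n ≠ 0) {p q pt qt : ℝ≥0∞}
    (hp : 1 ≤ p) (hpq : p ≤ q) (hpt : 1 ≤ pt) (hptqt : pt ≤ qt) {α β : ℝ}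
    (hβ : -((n : ℝ) * (q⁻¹).toReal) < β) (hα : α < (n : ℝ) * (1 - (p⁻¹).toReal))
    (hΛ : β + ((n : ℝ) - 1) * (q⁻¹).toReal - ((n : ℝ) - 1) * (qt⁻¹).toReal
        ≤ α + ((n : ℝ) - 1) * (p⁻¹).toReal - ((n : ℝ) - 1) * (pt⁻¹).toReal)
    (η : Fin n → ℕ) :
    ∃ C : ℝ, 0 < C ∧ ∀ u : (𝔼 n) → ℝ, Measurable u → ∀ t : ℝ, 0 < t →
      mixedNorm n q qt (fun x => ‖x‖ ^ β * conv n (multiDeriv n η (heatKernel n t)) u x) ≤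
        ENNReal.ofReal (C * t ^ (-(((∑ i, (η i : ℝ)) + (n : ℝ) * (p⁻¹).toReal -
          (n : ℝ) * (q⁻¹).toReal + α - β) / 2))) * mixedNorm n p pt (fun x => ‖x‖ ^ α * u x) := by
  have hq : 1 ≤ q := hp.trans hpq
  obtain ⟨C₁, hC₁, h₁⟩ := enorm_conv_multiDeriv_heatKernel_le n η
  obtain ⟨C₂, hC₂, h₂⟩ := radialNorm_gauss_conv_le hn hp hpq hpt hptqt hβ hα hΛ
  refine ⟨C₁ * C₂, by positivity, fun u hu t ht => ?_⟩
  obtain ⟨s, hs, rfl⟩ : ∃ s : ℝ, 0 < s ∧ s ^ 2 = t :=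
    ⟨Real.sqrt t, Real.sqrt_pos.2 ht, Real.sq_sqrt ht.le⟩
  rw [mixedNorm_rpow_mul_eq_radialNorm hn hq, mixedNorm_rpow_mul_eq_radialNorm hn hp]
  set e := ∑ i, (η i : ℝ) with he
  set F := conv n (multiDeriv n η (heatKernel n (s ^ 2))) u with hF
  set a := ((n : ℝ) - 1) * (q⁻¹).toReal + β with ha
  set a' := ((n : ℝ) - 1) * (p⁻¹).toReal + α with ha'
  set φ := fun ρ => ENNReal.ofReal (ρ ^ a) * angNorm n qt F ρ with hφ
  set ψ := fun ρ => ENNReal.ofReal (ρ ^ a') * angNorm n pt u ρ with hψ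
  set U : (𝔼 n) → ℝ≥0∞ := fun y => ‖u (s • y)‖ₑ with hU
  have hUm : Measurable U := (hu.comp (measurable_const_smul s)).enorm
  have hφs : radialNorm q (fun ρ => φ (s * ρ)) ≤ ENNReal.ofReal (C₁ * s ^ (a - e) * C₂) *
      radialNorm p (fun ρ => ENNReal.ofReal (ρ ^ a') *
        eLpNorm (fun θ : 𝕊 n => U (ρ • (θ : 𝔼 n))) pt (sphereMeasure n)) := by
    rw [ENNReal.ofReal_mul (by positivity), mul_assoc]
    refine le_trans ?_ (mul_le_mul_right (h₂ U hUm) _)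
    rw [← radialNorm_const_mul hq ENNReal.ofReal_ne_top]
    refine radialNorm_mono fun ρ hρ => ?_
    have hang : angNorm n qt F (s * ρ) ≤ ENNReal.ofReal (C₁ * s ^ (-e)) *
        eLpNorm (fun θ : 𝕊 n => ∫⁻ y, ENNReal.ofReal
          (Real.exp (-‖ρ • (θ : 𝔼 n) - y‖ ^ 2 / 8)) * U y) qt (sphereMeasure n) := by
      refine eLpNorm_le_ofReal_mul (fun θ => ?_) qt
      rw [mul_smul, enorm_eq_self]
      exact h₁ u s (ρ • (θ : 𝔼 n)) hs
    refine (mul_le_mul_right hang _).trans_eq ?_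
    rw [← mul_assoc, ← mul_assoc, ← ENNReal.ofReal_mul (by positivity),
      ← ENNReal.ofReal_mul (by positivity), Real.mul_rpow hs.le hρ.le, sub_eq_add_neg,
      Real.rpow_add hs a (-e)]
    congr 2; ring
  have hψs : radialNorm p (fun ρ => ENNReal.ofReal (ρ ^ a') *
        eLpNorm (fun θ : 𝕊 n => U (ρ • (θ : 𝔼 n))) pt (sphereMeasure n)) ≤
      ENNReal.ofReal (s ^ (-a')) * (ENNReal.ofReal (s ^ (-(p⁻¹).toReal)) * radialNorm p ψ) := by
    rw [← radialNorm_comp_mul_left hp hs, ← radialNorm_const_mul hp ENNReal.ofReal_ne_top]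
    refine radialNorm_mono fun ρ hρ => le_of_eq ?_
    have hUu : (fun θ : 𝕊 n => U (ρ • (θ : 𝔼 n))) =
        fun θ : 𝕊 n => ‖u ((s * ρ) • (θ : 𝔼 n))‖ₑ := by simp only [hU, mul_smul]
    rw [hψ, hUu, eLpNorm_enorm, ← mul_assoc, ← ENNReal.ofReal_mul (by positivity), Real.mul_rpow hs.le hρ.le,
      ← mul_assoc, ← Real.rpow_add hs, neg_add_cancel, Real.rpow_zero, one_mul, angNorm]
  have hscale : radialNorm q φ =
      ENNReal.ofReal (s ^ (q⁻¹).toReal) * radialNorm q (fun ρ => φ (s * ρ)) := by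
    rw [radialNorm_comp_mul_left hq hs, ← mul_assoc, ← ENNReal.ofReal_mul (by positivity),
      ← Real.rpow_add hs, add_neg_cancel, Real.rpow_zero, ofReal_one, one_mul]
  calc radialNorm q φ ≤ ENNReal.ofReal (s ^ (q⁻¹).toReal) *
        (ENNReal.ofReal (C₁ * s ^ (a - e) * C₂) * (ENNReal.ofReal (s ^ (-a')) *
          (ENNReal.ofReal (s ^ (-(p⁻¹).toReal)) * radialNorm p ψ))) := by
        rw [hscale]
        gcongr
        exact hφs.trans (by gcongr)
    _ = _ := by
        rw [← mul_assoc, ← mul_assoc, ← mul_assoc, ← ENNReal.ofReal_mul (by positivity),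
          ← ENNReal.ofReal_mul (by positivity), ← ENNReal.ofReal_mul (by positivity)]
        congr 2
        calc _ = C₁ * C₂ * (s ^ (q⁻¹).toReal * s ^ (a - e) * s ^ (-a') * s ^ (-(p⁻¹).toReal)) := by
              ring
          _ = _ := by
              rw [← Real.rpow_add hs, ← Real.rpow_add hs, ← Real.rpow_add hs,
                ← Real.rpow_natCast s 2, ← Real.rpow_mul hs.le, ha, ha']
              congr 2
              push_cast
              ring

theorem ofReal_mul_volume_rpow_le {r : ℝ} (hr : 0 < r) {C : ℝ} (hC : 0 < C) {Φ : ℝ → ℝ≥0∞}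
    {M : ℝ≥0∞} (h : ∀ t, 0 < t → Φ t ≤ ENNReal.ofReal (C * t ^ (-(1 / r))) * M) {l : ℝ}
    (hl : 0 < l) :
    ENNReal.ofReal l * (volume {t : ℝ | t ∈ Ioi (0 : ℝ) ∧ ENNReal.ofReal l < Φ t}) ^ (1 / r) ≤
      ENNReal.ofReal C * M := by
  rcases eq_or_ne M ∞ with rfl | hM
  · rw [ENNReal.mul_top (by simp [hC])]; exact le_top
  set K := C * M.toReal / l with hK
  have hK0 : 0 ≤ K := by positivity
  have hsub : {t : ℝ | t ∈ Ioi (0 : ℝ) ∧ ENNReal.ofReal l < Φ t} ⊆ Ioc 0 (K ^ r) := by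
    rintro t ⟨ht, hlt⟩
    have ht : 0 < t := ht
    refine ⟨ht, ?_⟩
    have h1 := hlt.trans_le (h t ht)
    rw [← ENNReal.ofReal_toReal hM, ← ENNReal.ofReal_mul (by positivity)] at h1
    have h2 := (ENNReal.ofReal_lt_ofReal_iff_of_nonneg hl.le).1 h1
    have h3 : t ^ (1 / r) ≤ K := by
      rw [hK, le_div_iff₀ hl]
      rw [Real.rpow_neg ht.le] at h2
      have h4 : 0 < t ^ (1 / r) := by positivity
      calc t ^ (1 / r) * l ≤ t ^ (1 / r) * (C * (t ^ (1 / r))⁻¹ * M.toReal) := by gcongr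
        _ = C * M.toReal := by field_simp
    calc t = (t ^ (1 / r)) ^ r := by
          rw [← Real.rpow_mul ht.le, one_div_mul_cancel hr.ne', Real.rpow_one]
      _ ≤ K ^ r := by gcongr
  calc _ ≤ ENNReal.ofReal l * (volume (Ioc 0 (K ^ r))) ^ (1 / r) := by gcongr
    _ = ENNReal.ofReal (l * K) := by
        rw [Real.volume_Ioc, sub_zero, ENNReal.ofReal_rpow_of_nonneg (by positivity)
          (by positivity), ← Real.rpow_mul hK0, mul_one_div_cancel hr.ne', Real.rpow_one,
          ENNReal.ofReal_mul hl.le]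
    _ = _ := by
        rw [hK, mul_div_cancel₀ _ hl.ne', ENNReal.ofReal_mul hC.le, ENNReal.ofReal_toReal hM]

/-- the heat flow in weighted mixed radial-angular spaces belongs to
weak-`L^r` in time. -/
theorem stmt19 (n : ℕ) (hn : 2 ≤ n) (p q pt qt : ℝ≥0∞) (r : ℝ)
    (hp : 1 ≤ p) (hpq : p ≤ q) (hpt : 1 ≤ pt) (hptqt : pt ≤ qt)
    (hr0 : 0 < r)
    (α β : ℝ)
    (hβ : -((n : ℝ) * (q⁻¹).toReal) < β)
    (hα : α < (n : ℝ) * (1 - (p⁻¹).toReal))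
    (hΛ : β + ((n : ℝ) - 1) * (q⁻¹).toReal - ((n : ℝ) - 1) * (qt⁻¹).toReal
        ≤ α + ((n : ℝ) - 1) * (p⁻¹).toReal - ((n : ℝ) - 1) * (pt⁻¹).toReal)
    (η : Fin n → ℕ)
    (hexp : ((∑ i, (η i : ℝ)) + (n : ℝ) * (p⁻¹).toReal - (n : ℝ) * (q⁻¹).toReal
        + α - β) / 2 = 1 / r) :
    ∃ c : ℝ, 0 < c ∧ ∀ u₀ : EuclideanSpace ℝ (Fin n) → ℝ, Measurable u₀ →
      ∀ lam : ℝ, 0 < lam →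
      ENNReal.ofReal lam *
          (volume {t : ℝ | t ∈ Ioi (0 : ℝ) ∧ ENNReal.ofReal lam <
            mixedNorm n q qt
              (fun x => ‖x‖ ^ β * conv n (multiDeriv n η (heatKernel n t)) u₀ x)}) ^ (1 / r)
        ≤ ENNReal.ofReal c * mixedNorm n p pt (fun x => ‖x‖ ^ α * u₀ x) := by
  obtain ⟨C, hC, h⟩ := mixedNorm_conv_multiDeriv_heatKernel_le (by omega) hp hpq hpt hptqt hβ hα
    hΛ η
  simp only [hexp] at h
  exact ⟨C, hC, fun u hu l hl => ofReal_mul_volume_rpow_le hr0 hC (h u hu) hl⟩
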